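/- For every n ≥ 1, there exists an n-regular acyclic Borel bipartite graph with no Borel edge coloring with 2n − 2 colors. -/

import Mathlib

/-- The left shift action of a group `G` on the product space `G → X`:
`(γ • y) β = y (γ⁻¹ * β)`. -/
def shift {G : Type*} [Group G] {X : Type*} (γ : G) (y : G → X) : G → X :=
  fun β => y (γ⁻¹ * β)

/-- The free part `Free(X^G)` of the left shift action of `G` on `G → X`. -/
def freePart (G : Type*) [Group G] (X : Type*) : Set (G → X) :=
  {y | ∀ γ : G, γ ≠ 1 → shift γ y ≠ y}

/-- The Borel chromatic number of a (graph given by a) relation `G` on a measurable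
space `X`: the least cardinality of a standard Borel space `Y` admitting a Borel
(measurable) coloring `c : X → Y` with `c x ≠ c y` whenever `G x y`. -/
noncomputable def borelChromaticNumber {X : Type} [mX : MeasurableSpace X]
    (G : X → X → Prop) : Cardinal :=
  sInf {κ : Cardinal | ∃ (Y : Type) (mY : MeasurableSpace Y),
    @StandardBorelSpace Y mY ∧ Cardinal.mk Y = κ ∧
    ∃ c : X → Y, @Measurable X Y mX mY c ∧ ∀ x y, G x y → c x ≠ c y}

/-- The adjacency relation of the graph `G(Γ, X)` on the free part `Free(X^Γ)` determined
by a set `S` of generators of `Γ`: `x` and `y` are adjacent iff some `γ ∈ S` shifts `x`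
to `y` or `y` to `x`. -/
def cayleyAdj {Γ : Type} [Group Γ] (S : Set Γ) (X : Type) :
    ↥(freePart Γ X) → ↥(freePart Γ X) → Prop :=
  fun x y => ∃ γ ∈ S,
    shift γ (x : Γ → X) = (y : Γ → X) ∨ shift γ (y : Γ → X) = (x : Γ → X)

/-- A tree of positions without dead ends, given by levels and parents; it may have several
roots. -/
structure GameTree where
  Pos : Type
  len : Pos → ℕ
  par : Pos → Pos
  len_par : ∀ p, len (par p) = len p - 1
  exists_child : ∀ p, ∃ q, len q = len p + 1 ∧ par q = p

namespace GameTree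

/-- `q` is an immediate successor of `p`. -/
def Child (T : GameTree) (p q : T.Pos) : Prop := T.len q = T.len p + 1 ∧ T.par q = p

/-- The ancestor of `p` at level `m` (it is `p` itself if `m ≥ len p`). -/
def anc (T : GameTree) (p : T.Pos) (m : ℕ) : T.Pos := T.par^[T.len p - m] p

/-- An infinite branch. -/
structure Play (T : GameTree) where
  pos : ℕ → T.Pos
  len_pos : ∀ n, T.len (pos n) = n
  par_pos : ∀ n, T.par (pos (n + 1)) = pos n

/-- A choice of a successor for every position. A player uses only the values at positions whose
level has her parity. -/
structure Strat (T : GameTree) where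
  mv : T.Pos → T.Pos
  child : ∀ p, T.Child p (mv p)

variable {T : GameTree}

@[ext] theorem Play.ext {x y : T.Play} (h : ∀ n, x.pos n = y.pos n) : x = y := by
  cases x; cases y; congr; funext n; exact h n

theorem Play.child (x : T.Play) (n : ℕ) : T.Child (x.pos n) (x.pos (n + 1)) :=
  ⟨by rw [x.len_pos, x.len_pos], x.par_pos n⟩

/-- `x` follows `s` at all levels `n ≥ m` of parity `j`. -/
def FollowsFrom (j : ℕ) (s : T.Strat) (m : ℕ) (x : T.Play) : Prop :=
  ∀ n, m ≤ n → n % 2 = j → x.pos (n + 1) = s.mv (x.pos n)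

theorem anc_of_le {p : T.Pos} {m : ℕ} (h : T.len p ≤ m) : T.anc p m = p := by
  simp [anc, Nat.sub_eq_zero_of_le h]

@[simp] theorem anc_len (p : T.Pos) : T.anc p (T.len p) = p := anc_of_le le_rfl

theorem anc_par {p : T.Pos} {m : ℕ} (h : m < T.len p) : T.anc (T.par p) m = T.anc p m := by
  unfold anc
  rw [T.len_par, show T.len p - m = (T.len p - 1 - m) + 1 by omega, Function.iterate_succ_apply]

theorem Child.anc {p q : T.Pos} (h : T.Child p q) {m : ℕ} (hm : m ≤ T.len p) :
    T.anc q m = T.anc p m := by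
  rw [← h.2, anc_par (by have := h.1; omega)]

theorem len_anc {p : T.Pos} {m : ℕ} (h : m ≤ T.len p) : T.len (T.anc p m) = m := by
  have key : ∀ (k : ℕ) (q : T.Pos), T.len (T.par^[k] q) = T.len q - k := by
    intro k
    induction k with
    | zero => simp
    | succ k ih => intro q; rw [Function.iterate_succ_apply, ih, T.len_par]; omega
  rw [GameTree.anc, key]; omega

theorem Play.anc (x : T.Play) {m n : ℕ} (h : m ≤ n) : T.anc (x.pos n) m = x.pos m := by
  induction n, h using Nat.le_induction with
  | base => exact anc_of_le (by rw [x.len_pos])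
  | succ n hn ih => rw [(x.child n).anc (by rw [x.len_pos]; exact hn), ih]

theorem Play.eq_of_le {x y : T.Play} {m n : ℕ} (h : m ≤ n) (e : x.pos n = y.pos n) :
    x.pos m = y.pos m := by
  rw [← x.anc h, ← y.anc h, e]

theorem anc_child {p : T.Pos} {m : ℕ} (h : m < T.len p) :
    T.Child (T.anc p m) (T.anc p (m + 1)) := by
  refine ⟨by rw [len_anc h.le, len_anc h], ?_⟩
  unfold GameTree.anc
  rw [← Function.iterate_succ_apply' T.par, show T.len p - m = (T.len p - (m + 1)) + 1 by omega]

theorem anc_anc {p : T.Pos} {m n : ℕ} (h : m ≤ n) : T.anc (T.anc p n) m = T.anc p m := by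
  by_cases hn : T.len p ≤ n
  · rw [anc_of_le hn]
  · rw [GameTree.anc, len_anc (by omega)]
    unfold GameTree.anc
    rw [← Function.iterate_add_apply]
    congr 1; omega

open Classical in
/-- The strategy following `g` wherever `g` gives a legal move. -/
noncomputable def legalize (T : GameTree) (g : T.Pos → T.Pos) : T.Strat where
  mv p := if T.Child p (g p) then g p else (T.exists_child p).choose
  child p := by
    split_ifs with h
    · exact h
    · exact (T.exists_child p).choose_spec

theorem legalize_mv {g : T.Pos → T.Pos} {p : T.Pos} (h : T.Child p (g p)) :
    (T.legalize g).mv p = g p := if_pos h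

theorem legalize_congr {g g' : T.Pos → T.Pos} {p : T.Pos} (h : g p = g' p) :
    (T.legalize g).mv p = (T.legalize g').mv p := by
  unfold legalize
  simp only
  rw [h]

/-- The player of parity `j` can force the play, continued from `y`, to enter `U`. -/
def Force (j : ℕ) (U : Set T.Pos) (y : T.Pos) : Prop :=
  ∃ s : T.Strat, ∀ x : T.Play, x.pos (T.len y) = y → FollowsFrom j s (T.len y) x →
    ∃ n, T.len y ≤ n ∧ x.pos n ∈ U

theorem force_of_mem {j : ℕ} {U : Set T.Pos} {y : T.Pos} (h : y ∈ U) : Force j U y :=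
  ⟨T.legalize id, fun x hx _ => ⟨_, le_rfl, by rwa [hx]⟩⟩

theorem Force.of_child {j : ℕ} {U : Set T.Pos} {y z : T.Pos} (hj : T.len y % 2 = j)
    (hz : T.Child y z) (h : Force j U z) : Force j U y := by
  classical
  obtain ⟨s, hs⟩ := h
  refine ⟨T.legalize fun p => if p = y then z else s.mv p, fun x hx hf => ?_⟩
  have h1 : x.pos (T.len y + 1) = z := by
    rw [hf _ le_rfl hj, hx, legalize_mv] <;> simp [hz]
  obtain ⟨n, hn, hU⟩ := hs x (by rw [hz.1, h1]) (fun n hn hnj => by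
    have hne : x.pos n ≠ y := fun e => by
      have := x.len_pos n; rw [e] at this; have := hz.1; omega
    rw [hf n (by have := hz.1; omega) hnj, legalize_mv] <;> simp [hne, s.child])
  exact ⟨n, by have := hz.1; omega, hU⟩

theorem Force.of_forall_child {j : ℕ} {U : Set T.Pos} {y : T.Pos}
    (h : ∀ z, T.Child y z → Force j U z) : Force j U y := by
  classical
  have : Nonempty T.Strat := ⟨T.legalize id⟩
  choose! s hs using h
  refine ⟨T.legalize fun p => (s (T.anc p (T.len y + 1))).mv p, fun x hx hf => ?_⟩
  have hc : T.Child y (x.pos (T.len y + 1)) := by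
    have := x.child (T.len y); rwa [hx] at this
  obtain ⟨n, hn, hU⟩ := hs _ hc x (by rw [x.len_pos]) (fun n hn hnj => by
    rw [x.len_pos] at hn
    rw [hf n (by omega) hnj, legalize_mv, x.anc hn]
    exact (s _).child _)
  rw [x.len_pos] at hn
  exact ⟨n, by omega, hU⟩

/-- A strategy witnessing `Force j U y`. -/
noncomputable def forceStrat (j : ℕ) (U : Set T.Pos) (y : T.Pos) : T.Strat :=
  open Classical in if h : Force j U y then h.choose else T.legalize id

theorem forceStrat_spec {j : ℕ} {U : Set T.Pos} {y : T.Pos} (h : Force j U y) {x : T.Play}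
    (hx : x.pos (T.len y) = y) (hf : FollowsFrom j (forceStrat j U y) (T.len y) x) :
    ∃ n, T.len y ≤ n ∧ x.pos n ∈ U := by
  rw [forceStrat, dif_pos h] at hf
  exact h.choose_spec x hx hf

/-- The least level `m ≥ L` at which the ancestor of `p` lies in `V`. -/
noncomputable def firstHit (T : GameTree) (L : ℕ) (V : Set T.Pos) (p : T.Pos) : ℕ :=
  sInf {m | L ≤ m ∧ m ≤ T.len p ∧ T.anc p m ∈ V}

/-- Some ancestor of `p` at level at least `L` lies in `V`. -/
def Hits (T : GameTree) (L : ℕ) (V : Set T.Pos) (p : T.Pos) : Prop :=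
  ∃ m, L ≤ m ∧ m ≤ T.len p ∧ T.anc p m ∈ V

theorem Play.hits_iff (x : T.Play) {L n : ℕ} {V : Set T.Pos} :
    T.Hits L V (x.pos n) ↔ ∃ m, L ≤ m ∧ m ≤ n ∧ x.pos m ∈ V := by
  simp only [Hits, x.len_pos]
  refine exists_congr fun m => and_congr_right fun _ => and_congr_right fun h => ?_
  rw [x.anc h]

theorem Play.firstHit_eq (x : T.Play) {L m n : ℕ} {V : Set T.Pos} (hL : L ≤ m) (hmn : m ≤ n)
    (hm : x.pos m ∈ V) (hlt : ∀ i, L ≤ i → i < m → x.pos i ∉ V) :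
    T.firstHit L V (x.pos n) = m := by
  have hmem : m ∈ {i | L ≤ i ∧ i ≤ T.len (x.pos n) ∧ T.anc (x.pos n) i ∈ V} :=
    ⟨hL, by rwa [x.len_pos], by rwa [x.anc hmn]⟩
  refine le_antisymm (Nat.sInf_le hmem) ?_
  obtain ⟨h1, h2, h3⟩ := Nat.sInf_mem ⟨m, hmem⟩
  by_contra hcon
  rw [x.anc (h2.trans (x.len_pos n).le)] at h3
  exact hlt _ h1 (not_le.1 hcon) h3

open Classical in
/-- The strategy which waits, following `d`, until entering `U` can be forced, then forces it, and
after entering `U` at `u` follows `t u`. -/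
noncomputable def phase (j L : ℕ) (U : Set T.Pos) (t : T.Pos → T.Strat) (d : T.Strat) : T.Strat :=
  T.legalize fun p =>
    if T.Hits L U p then (t (T.anc p (T.firstHit L U p))).mv p
    else if T.Hits L {y | Force j U y} p then
      (forceStrat j U (T.anc p (T.firstHit L {y | Force j U y} p))).mv p
    else d.mv p

theorem phase_congr {j L : ℕ} {U U' : Set T.Pos} {t t' : T.Pos → T.Strat} {d d' : T.Strat}
    {p : T.Pos} (hU : U = U') (ht : ∀ u, (t u).mv p = (t' u).mv p) (hd : d.mv p = d'.mv p) :
    (phase j L U t d).mv p = (phase j L U' t' d').mv p := by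
  apply legalize_congr
  simp only [ht, hd]
  rw [hU]

theorem phase_spec {j L : ℕ} {U : Set T.Pos} {t : T.Pos → T.Strat} {d : T.Strat}
    {x : T.Play} (hx : FollowsFrom j (phase j L U t d) L x) :
    (∃ n, L ≤ n ∧ x.pos n ∈ U ∧ FollowsFrom j (t (x.pos n)) n x) ∨
      ((∀ n, L ≤ n → ¬ Force j U (x.pos n)) ∧ FollowsFrom j d L x) := by
  classical
  have step : ∀ n, L ≤ n → n % 2 = j → x.pos (n + 1) =
      if T.Hits L U (x.pos n) then (t (T.anc (x.pos n) (T.firstHit L U (x.pos n)))).mv (x.pos n)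
      else if T.Hits L {y | Force j U y} (x.pos n) then
        (forceStrat j U (T.anc (x.pos n) (T.firstHit L {y | Force j U y} (x.pos n)))).mv (x.pos n)
      else d.mv (x.pos n) := by
    intro n hn hj
    rw [hx n hn hj, phase, legalize_mv]
    · split_ifs
      exacts [(t _).child _, (forceStrat _ _ _).child _, d.child _]
  by_cases hA : ∃ n, L ≤ n ∧ x.pos n ∈ U
  · left
    obtain ⟨h1, h2⟩ := Nat.find_spec hA
    have hmin : ∀ i, L ≤ i → i < Nat.find hA → x.pos i ∉ U := fun i hi hlt hmem =>
      Nat.find_min hA hlt ⟨hi, hmem⟩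
    refine ⟨Nat.find hA, h1, h2, fun n hn hj => ?_⟩
    rw [step n (h1.trans hn) hj]
    rw [if_pos (x.hits_iff.2 ⟨_, h1, hn, h2⟩), x.firstHit_eq h1 hn h2 hmin, x.anc hn]
  · right
    have hnoU : ∀ n, ¬ T.Hits L U (x.pos n) := fun n hh => by
      obtain ⟨m, h1, -, h3⟩ := x.hits_iff.1 hh
      exact hA ⟨m, h1, h3⟩
    have hnoF : ¬ ∃ n, L ≤ n ∧ x.pos n ∈ {y | Force j U y} := by
      intro hF
      obtain ⟨h1, h2⟩ := Nat.find_spec hF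
      have hmin : ∀ i, L ≤ i → i < Nat.find hF → x.pos i ∉ {y | Force j U y} :=
        fun i hi hlt hmem => Nat.find_min hF hlt ⟨hi, hmem⟩
      obtain ⟨m, hm, hmU⟩ := forceStrat_spec (x := x) h2 (by rw [x.len_pos]) (fun n hn hj => by
        rw [x.len_pos] at hn
        rw [step n (h1.trans hn) hj]
        rw [if_neg (hnoU n), if_pos (x.hits_iff.2 ⟨_, h1, hn, h2⟩), x.firstHit_eq h1 hn h2 hmin,
          x.anc hn])
      rw [x.len_pos] at hm
      exact hA ⟨m, h1.trans hm, hmU⟩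
    refine ⟨fun n hn hF => hnoF ⟨n, hn, hF⟩, fun n hn hj => ?_⟩
    rw [step n hn hj]
    rw [if_neg (hnoU n), if_neg]
    intro hh
    obtain ⟨m, h1, -, h3⟩ := x.hits_iff.1 hh
    exact hnoF ⟨m, h1, h3⟩

end GameTree

namespace GameTree

variable {T T' : GameTree}

/-- A covering of `T` by `T'`: a projection of positions together with a lifting of strategies. -/
structure Cover (T' T : GameTree) where
  π : T'.Pos → T.Pos
  len_π : ∀ p, T.len (π p) = T'.len p
  par_π : ∀ p, T.par (π p) = π (T'.par p)
  φ : ℕ → T'.Strat → T.Strat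
  φ_congr : ∀ j s s' n, (∀ p, T'.len p < n → s.mv p = s'.mv p) →
    ∀ p, T.len p < n → (φ j s).mv p = (φ j s').mv p
  lift : ∀ j < 2, ∀ s (x : T.Play), FollowsFrom j (φ j s) 0 x →
    ∃ y : T'.Play, FollowsFrom j s 0 y ∧ ∀ n, π (y.pos n) = x.pos n

/-- The covering is an isomorphism up to level `k`. -/
structure Cover.IsIdUpTo (C : Cover T' T) (k : ℕ) : Prop where
  exists_unique : ∀ p, T.len p ≤ k → ∃! q, C.π q = p
  φ_mv : ∀ j s q, T'.len q < k → (C.φ j s).mv (C.π q) = C.π (s.mv q)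

/-- A map of positions respecting levels and parents. -/
structure Hom (U T : GameTree) where
  map : U.Pos → T.Pos
  len_map : ∀ p, T.len (map p) = U.len p
  par_map : ∀ p, T.par (map p) = map (U.par p)

/-- The induced map of plays. -/
def Hom.play (f : Hom T' T) (x : T'.Play) : T.Play where
  pos n := f.map (x.pos n)
  len_pos n := by rw [f.len_map, x.len_pos]
  par_pos n := by rw [f.par_map, x.par_pos]

/-- The identity. -/
def Hom.id (T : GameTree) : Hom T T := ⟨fun p => p, fun _ => rfl, fun _ => rfl⟩

/-- Composition. -/
def Hom.comp {T'' : GameTree} (f : Hom T' T) (g : Hom T'' T') : Hom T'' T where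
  map p := f.map (g.map p)
  len_map p := by rw [f.len_map, g.len_map]
  par_map p := by rw [f.par_map, g.par_map]

/-- The projection of a covering. -/
def Cover.hom (C : Cover T' T) : Hom T' T := ⟨C.π, C.len_π, C.par_π⟩

theorem Hom.child (f : Hom T' T) {p q : T'.Pos} (h : T'.Child p q) :
    T.Child (f.map p) (f.map q) :=
  ⟨by rw [f.len_map, f.len_map, h.1], by rw [f.par_map, h.2]⟩

/-- Composition of coverings. -/
def Cover.comp {T'' : GameTree} (C : Cover T' T) (D : Cover T'' T') : Cover T'' T where
  π p := C.π (D.π p)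
  len_π p := by rw [C.len_π, D.len_π]
  par_π p := by rw [C.par_π, D.par_π]
  φ j s := C.φ j (D.φ j s)
  φ_congr j s s' n h := C.φ_congr j _ _ n (D.φ_congr j s s' n h)
  lift j hj s x hx := by
    obtain ⟨y, hy, hyx⟩ := C.lift j hj _ x hx
    obtain ⟨z, hz, hzy⟩ := D.lift j hj _ y hy
    exact ⟨z, hz, fun n => by rw [hzy, hyx]⟩

theorem Cover.IsIdUpTo.mono {C : Cover T' T} {k l : ℕ} (h : C.IsIdUpTo k) (hl : l ≤ k) :
    C.IsIdUpTo l :=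
  ⟨fun p hp => h.1 p (hp.trans hl), fun j s q hq => h.2 j s q (hq.trans_le hl)⟩

theorem Cover.IsIdUpTo.inj {C : Cover T' T} {k : ℕ} (h : C.IsIdUpTo k) {p q : T'.Pos}
    (hp : T'.len p ≤ k) (e : C.π p = C.π q) : p = q :=
  (h.1 (C.π p) (by rwa [C.len_π])).unique rfl e.symm

theorem Cover.IsIdUpTo.comp {T'' : GameTree} {C : Cover T' T} {D : Cover T'' T'} {k : ℕ}
    (hC : C.IsIdUpTo k) (hD : D.IsIdUpTo k) : (C.comp D).IsIdUpTo k where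
  exists_unique p hp := by
    obtain ⟨q, hq, -⟩ := hC.1 p hp
    have hlq : T'.len q ≤ k := by rwa [← C.len_π, hq]
    obtain ⟨r, hr, -⟩ := hD.1 q hlq
    have hlr : T''.len r ≤ k := by rwa [← D.len_π, hr]
    refine ⟨r, by simp [Cover.comp, hr, hq], fun r' hr' => ?_⟩
    have hr'' : C.π (D.π r') = p := hr'
    refine (hD.inj hlr (hC.inj (by rwa [hr]) ?_)).symm
    rw [hr, hq, hr'']
  φ_mv j s q hq := by
    change (C.φ j (D.φ j s)).mv (C.π (D.π q)) = C.π (D.π (s.mv q))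
    rw [hC.2 _ _ _ (by rwa [D.len_π]), hD.2 _ _ _ hq]

/-- Membership in `B` depends only on the position at level `N`. -/
def Decided (N : ℕ) (B : Set T.Play) : Prop :=
  ∀ x y : T.Play, x.pos N = y.pos N → (x ∈ B ↔ y ∈ B)

/-- Some covering which is an isomorphism up to level `k` makes `B` decided at a finite level. -/
def Unravels (T : GameTree) (k : ℕ) (B : Set T.Play) : Prop :=
  ∃ (T' : GameTree) (C : Cover T' T), C.IsIdUpTo k ∧ ∃ N, Decided N (C.hom.play ⁻¹' B)

section Limit

variable {S : ℕ → GameTree} (C : ∀ i, Cover (S (i + 1)) (S i))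

/-- Coherent sequences of positions. -/
def Thread : Type := {p : ∀ i, (S i).Pos // ∀ i, (C i).π (p (i + 1)) = p i}

variable {C}

theorem Thread.len_eq (p : Thread C) (i : ℕ) : (S i).len (p.1 i) = (S 0).len (p.1 0) := by
  induction i with
  | zero => rfl
  | succ i ih => rw [← ih, ← p.2 i, (C i).len_π]

theorem Thread.ext {p q : Thread C} {k : ℕ} (hC : ∀ i, (C i).IsIdUpTo (k + i)) {i : ℕ}
    (hl : (S 0).len (p.1 0) ≤ k + i) (h : p.1 i = q.1 i) : p = q := by
  have down : ∀ d, p.1 d = q.1 d → p.1 0 = q.1 0 := by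
    intro d
    induction d with
    | zero => exact id
    | succ d ih => intro e; apply ih; rw [← p.2, ← q.2, e]
  have down' : ∀ d, d ≤ i → p.1 d = q.1 d := by
    intro d hd
    induction hd using Nat.decreasingInduction with
    | self => exact h
    | of_succ d _ ih => rw [← p.2, ← q.2, ih]
  have up : ∀ d, i ≤ d → p.1 d = q.1 d := by
    intro d hd
    induction d, hd using Nat.le_induction with
    | base => exact h
    | succ d hd ih =>
      exact (hC d).inj (by rw [p.len_eq]; omega) (by rw [p.2, q.2, ih])
  exact Subtype.ext (funext fun d => (le_total d i).elim (down' d) (up d))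

theorem Thread.exists {k : ℕ} (hC : ∀ i, (C i).IsIdUpTo (k + i)) (i : ℕ) (q : (S i).Pos)
    (hq : (S i).len q ≤ k + i) : ∃ p : Thread C, p.1 i = q := by
  induction i generalizing S k with
  | zero =>
    have step : ∀ i (r : {r : (S i).Pos // (S i).len r ≤ k}),
        ∃ r' : {r : (S (i + 1)).Pos // (S (i + 1)).len r ≤ k}, (C i).π r'.1 = r.1 := by
      rintro i ⟨r, hr⟩
      obtain ⟨r', hr', -⟩ := (hC i).1 r (by omega)
      exact ⟨⟨r', by rwa [← (C i).len_π, hr']⟩, hr'⟩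
    choose f hf using step
    let g : ∀ i, {r : (S i).Pos // (S i).len r ≤ k} := fun i =>
      Nat.rec (motive := fun i => {r : (S i).Pos // (S i).len r ≤ k}) ⟨q, hq⟩ f i
    exact ⟨⟨fun i => (g i).1, fun i => hf i (g i)⟩, rfl⟩
  | succ i ih =>
    obtain ⟨p, hp⟩ := ih (S := fun i => S (i + 1)) (C := fun i => C (i + 1)) (k := k + 1)
      (fun i => by rw [show k + 1 + i = k + (i + 1) by omega]; exact hC (i + 1)) q (by omega)
    exact ⟨⟨fun j => Nat.casesOn j ((C 0).π (p.1 0)) p.1, fun j => by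
      cases j with
      | zero => rfl
      | succ j => exact p.2 j⟩, hp⟩

/-- The parent of a coherent sequence. -/
def Thread.par (p : Thread C) : Thread C :=
  ⟨fun i => (S i).par (p.1 i), fun i => by rw [← (C i).par_π, p.2]⟩

variable {k : ℕ}

/-- The inverse limit of a sequence of coverings. -/
def limit (C : ∀ i, Cover (S (i + 1)) (S i)) (hC : ∀ i, (C i).IsIdUpTo (k + i)) : GameTree where
  Pos := Thread C
  len p := (S 0).len (p.1 0)
  par := Thread.par
  len_par p := (S 0).len_par _
  exists_child p := by
    obtain ⟨q, hq, hqp⟩ := (S _).exists_child (p.1 ((S 0).len (p.1 0) + 1))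
    replace hq := hq.trans (congrArg (· + 1) (p.len_eq _))
    obtain ⟨r, hr⟩ := Thread.exists hC _ q (by omega)
    have hl : (S 0).len (r.1 0) = (S 0).len (p.1 0) + 1 := by rw [← r.len_eq, hr, hq]
    refine ⟨r, hl, Thread.ext hC (i := (S 0).len (p.1 0) + 1) ?_ ?_⟩
    · change (S 0).len ((S 0).par (r.1 0)) ≤ _
      rw [(S 0).len_par]; omega
    · change (S _).par (r.1 _) = _
      rw [hr, hqp]

variable {hC : ∀ i, (C i).IsIdUpTo (k + i)}

theorem Thread.len_eq' (p : (limit C hC).Pos) (i : ℕ) :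
    (S i).len (p.1 i) = (limit C hC).len p := Thread.len_eq p i

/-- The projections of the inverse limit. -/
def limitHom (C : ∀ i, Cover (S (i + 1)) (S i)) (hC : ∀ i, (C i).IsIdUpTo (k + i)) (i : ℕ) :
    Hom (limit C hC) (S i) where
  map p := p.1 i
  len_map p := Thread.len_eq p i
  par_map _ := rfl

open Classical in
/-- The strategy induced on `S i` at the levels where `S i` agrees with the limit. -/
noncomputable def limitStrat₀ (s : (limit C hC).Strat) (i : ℕ) : (S i).Strat :=
  (S i).legalize fun q =>
    if h : ∃ p : (limit C hC).Pos, p.1 i = q ∧ (S i).len q < k + i then (s.mv h.choose).1 i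
    else q

theorem limitStrat₀_mv (s : (limit C hC).Strat) {i : ℕ} {p : (limit C hC).Pos}
    (hp : (limit C hC).len p < k + i) : (limitStrat₀ s i).mv (p.1 i) = (s.mv p).1 i := by
  have h : ∃ p' : (limit C hC).Pos, p'.1 i = p.1 i ∧ (S i).len (p.1 i) < k + i :=
    ⟨p, rfl, by rwa [Thread.len_eq' p]⟩
  have e : h.choose = p := by
    refine (Thread.ext hC (i := i) ?_ h.choose_spec.1.symm).symm
    exact hp.le
  rw [limitStrat₀, legalize_mv]
  · rw [dif_pos h, e]
  · rw [dif_pos h, e]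
    exact (limitHom C hC i).child (s.child p)

/-- The strategy induced on `S i` by the one on `S (i + d)`. -/
noncomputable def limitStratApprox (j : ℕ) (s : (limit C hC).Strat) : ℕ → ∀ i, (S i).Strat
  | 0, i => limitStrat₀ s i
  | d + 1, i => (C i).φ j (limitStratApprox j s d (i + 1))

theorem limitStratApprox_succ (j : ℕ) (s : (limit C hC).Strat) (d i : ℕ) (q : (S i).Pos)
    (hq : (S i).len q < k + i + d) :
    (limitStratApprox j s (d + 1) i).mv q = (limitStratApprox j s d i).mv q := by
  induction d generalizing i with
  | zero =>
    obtain ⟨p, rfl⟩ : ∃ p : (limit C hC).Pos, p.1 i = q := Thread.exists hC i q (by omega)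
    have hp : (limit C hC).len p < k + i := by rwa [← Thread.len_eq' p i]
    change ((C i).φ j (limitStrat₀ s (i + 1))).mv _ = (limitStrat₀ s i).mv _
    rw [limitStrat₀_mv s hp, ← p.2 i, (hC i).2 _ _ _ (by rw [Thread.len_eq' p]; omega),
      limitStrat₀_mv s (i := i + 1) (p := p) (by omega), (s.mv p).2]
  | succ d ih => exact (C i).φ_congr j _ _ (k + i + (d + 1)) (fun p hp => ih _ p (by omega)) q hq

theorem limitStratApprox_of_le (j : ℕ) (s : (limit C hC).Strat) {d d' i : ℕ} (h : d ≤ d')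
    {q : (S i).Pos} (hq : (S i).len q < k + i + d) :
    (limitStratApprox j s d' i).mv q = (limitStratApprox j s d i).mv q := by
  induction d', h using Nat.le_induction with
  | base => rfl
  | succ d' h ih => rw [limitStratApprox_succ j s d' i q (by omega), ih]

/-- The strategy induced on `S i` by a strategy on the limit. -/
noncomputable def limitStrat (j : ℕ) (s : (limit C hC).Strat) (i : ℕ) : (S i).Strat :=
  (S i).legalize fun q => (limitStratApprox j s ((S i).len q + 1) i).mv q

theorem limitStrat_mv (j : ℕ) (s : (limit C hC).Strat) {d i : ℕ} {q : (S i).Pos}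
    (hq : (S i).len q < k + i + d) :
    (limitStrat j s i).mv q = (limitStratApprox j s d i).mv q := by
  refine (legalize_mv (Strat.child _ _)).trans ?_
  rcases le_total d ((S i).len q + 1) with h | h
  · exact limitStratApprox_of_le j s h hq
  · exact (limitStratApprox_of_le j s h (by omega)).symm

theorem φ_limitStrat (j : ℕ) (s : (limit C hC).Strat) (i : ℕ) (q : (S i).Pos) :
    ((C i).φ j (limitStrat j s (i + 1))).mv q = (limitStrat j s i).mv q := by
  rw [limitStrat_mv j s (d := (S i).len q + 2) (by omega)]
  refine (C i).φ_congr j _ _ ((S i).len q + 1) (fun p hp => ?_) q (by omega)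
  exact limitStrat_mv j s (by omega)

theorem limitStrat_mv_of_lt (j : ℕ) (s : (limit C hC).Strat) {i : ℕ} {p : (limit C hC).Pos}
    (hp : (limit C hC).len p < k + i) : (limitStrat j s i).mv (p.1 i) = (s.mv p).1 i := by
  rw [limitStrat_mv j s (d := 0) (by rw [Thread.len_eq' p]; omega)]
  exact limitStrat₀_mv s hp

theorem limitStrat_congr (j : ℕ) {s s' : (limit C hC).Strat} {n : ℕ}
    (h : ∀ p, (limit C hC).len p < n → s.mv p = s'.mv p) (i : ℕ) (q : (S i).Pos)
    (hq : (S i).len q < n) : (limitStrat j s i).mv q = (limitStrat j s' i).mv q := by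
  have key : ∀ d i (q : (S i).Pos), (S i).len q < n →
      (limitStratApprox j s d i).mv q = (limitStratApprox j s' d i).mv q := by
    intro d
    induction d with
    | zero =>
      intro i q hq
      apply legalize_congr
      split_ifs with hh
      · rw [h _ (by rw [← Thread.len_eq' hh.choose i, hh.choose_spec.1]; exact hq)]
      · rfl
    | succ d ih => exact fun i q hq => (C i).φ_congr j _ _ n (ih (i + 1)) q hq
  exact legalize_congr (key _ i q hq)

/-- The covering of `S 0` by the inverse limit. -/
noncomputable def limitCover (C : ∀ i, Cover (S (i + 1)) (S i))
    (hC : ∀ i, (C i).IsIdUpTo (k + i)) : Cover (limit C hC) (S 0) where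
  π p := p.1 0
  len_π _ := rfl
  par_π _ := rfl
  φ j s := limitStrat j s 0
  φ_congr j _ _ _ h p hp := limitStrat_congr j h 0 p hp
  lift j hj s x hx := by
    have step : ∀ i (x : {x : (S i).Play // FollowsFrom j (limitStrat j s i) 0 x}),
        ∃ y : {y : (S (i + 1)).Play // FollowsFrom j (limitStrat j s (i + 1)) 0 y},
          ∀ n, (C i).π (y.1.pos n) = x.1.pos n := by
      rintro i ⟨x, hx⟩
      obtain ⟨y, hy, hyx⟩ := (C i).lift j hj (limitStrat j s (i + 1)) x
        (fun n hn hj => by rw [φ_limitStrat]; exact hx n hn hj)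
      exact ⟨⟨y, hy⟩, hyx⟩
    choose f hf using step
    let g : ∀ i, {x : (S i).Play // FollowsFrom j (limitStrat j s i) 0 x} := fun i =>
      Nat.rec (motive := fun i => {x : (S i).Play // FollowsFrom j (limitStrat j s i) 0 x})
        ⟨x, hx⟩ f i
    let y : (limit C hC).Play :=
      { pos := fun n => ⟨fun i => (g i).1.pos n, fun i => hf i (g i) n⟩
        len_pos := fun n => (g 0).1.len_pos n
        par_pos := fun n => Subtype.ext (funext fun i => (g i).1.par_pos n) }
    refine ⟨y, fun n _ hj => ?_, fun n => rfl⟩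
    refine Thread.ext hC (i := n + 1) ?_ ?_
    · have : (limit C hC).len (y.pos (n + 1)) = n + 1 := y.len_pos _
      change (limit C hC).len (y.pos (n + 1)) ≤ _
      omega
    · rw [← limitStrat_mv_of_lt j s (by rw [y.len_pos]; omega)]
      exact (g (n + 1)).2 n (Nat.zero_le _) hj

theorem limitCover_isIdUpTo : (limitCover C hC).IsIdUpTo k where
  exists_unique q hq := by
    obtain ⟨p, hp⟩ := Thread.exists hC 0 q hq
    refine ⟨p, hp, fun p' hp' => Thread.ext hC (i := 0) ?_ ?_⟩
    · have : p'.1 0 = q := hp'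
      rw [this]; exact hq
    · exact (show p'.1 0 = q from hp').trans hp.symm
  φ_mv j s _ hq := limitStrat_mv_of_lt j s (i := 0) hq

end Limit

end GameTree

namespace GameTree

variable {T : GameTree}

/-- `S` is a subtree without dead ends of the tree of positions extending `p`. -/
structure IsSub (S : Set T.Pos) (p : T.Pos) : Prop where
  mem : p ∈ S
  par_mem : ∀ y ∈ S, y = p ∨ T.len p < T.len y ∧ T.par y ∈ S
  exists_child : ∀ y ∈ S, ∃ z ∈ S, T.Child y z

theorem IsSub.anc_eq {S : Set T.Pos} {p y : T.Pos} (h : IsSub S p) (hy : y ∈ S) :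
    T.anc y (T.len p) = p := by
  induction hn : T.len y using Nat.strong_induction_on generalizing y with
  | _ n ih =>
    rcases h.par_mem y hy with rfl | ⟨h1, h2⟩
    · exact anc_len _
    · rw [← anc_par h1]
      exact ih _ (by rw [T.len_par]; omega) h2 rfl

/-- The positions extending `p` along which no position from `p` on lies in `B`. -/
def avoid (T : GameTree) (B : Set T.Pos) (p : T.Pos) : Set T.Pos :=
  {y | T.len p ≤ T.len y ∧ T.anc y (T.len p) = p ∧
    ∀ m, T.len p ≤ m → m ≤ T.len y → T.anc y m ∉ B}

theorem not_mem_of_mem_avoid {B : Set T.Pos} {p y : T.Pos} (h : y ∈ T.avoid B p) : y ∉ B := by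
  simpa using h.2.2 _ h.1 le_rfl

theorem self_mem_avoid {B : Set T.Pos} {p : T.Pos} (h : p ∉ B) : p ∈ T.avoid B p :=
  ⟨le_rfl, anc_len p, fun m h1 h2 => by rwa [le_antisymm h2 h1, anc_len]⟩

theorem child_mem_avoid {B : Set T.Pos} {p y z : T.Pos} (hy : y ∈ T.avoid B p)
    (hz : T.Child y z) (h : z ∉ B) : z ∈ T.avoid B p := by
  obtain ⟨h1, h2, h3⟩ := hy
  have := hz.1
  refine ⟨by omega, by rw [hz.anc h1, h2], fun m hm hm' => ?_⟩
  rcases Nat.lt_or_ge (T.len y) m with hlt | hle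
  · rwa [anc_of_le (by omega)]
  · rw [hz.anc hle]; exact h3 m hm hle

theorem isSub_avoid {B : Set T.Pos} {p : T.Pos} (hp : p ∉ B)
    (h : ∀ y ∈ T.avoid B p, ∃ z, T.Child y z ∧ z ∉ B) : IsSub (T.avoid B p) p where
  mem := self_mem_avoid hp
  par_mem y hy := by
    obtain ⟨h1, h2, h3⟩ := hy
    rcases h1.eq_or_lt with h1 | h1
    · left; rw [← h2, h1, anc_len]
    · refine .inr ⟨h1, by rw [T.len_par]; omega, by rw [anc_par h1, h2], fun m hm hm' => ?_⟩
      rw [T.len_par] at hm'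
      rw [anc_par (by omega)]
      exact h3 m hm (by omega)
  exists_child y hy := by
    obtain ⟨z, hz, hzB⟩ := h y hy
    exact ⟨z, child_mem_avoid hy hz hzB, hz⟩

/-- The positions of level at least `L` comparable with `u`. -/
def comparable (T : GameTree) (L : ℕ) (u : T.Pos) : Set T.Pos :=
  T.avoid {z | T.len z ≤ T.len u ∧ z ≠ T.anc u (T.len z)} (T.anc u L)

theorem exists_child_anc (u : T.Pos) (y : T.Pos) (h : T.len y ≤ T.len u → y = T.anc u (T.len y)) :
    ∃ z, T.Child y z ∧ (T.len z ≤ T.len u → z = T.anc u (T.len z)) := by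
  rcases Nat.lt_or_ge (T.len y) (T.len u) with hl | hl
  · refine ⟨T.anc u (T.len y + 1), ?_, fun _ => by rw [len_anc hl]⟩
    have := anc_child hl
    rwa [← h hl.le] at this
  · obtain ⟨z, hz⟩ := T.exists_child y
    exact ⟨z, hz, fun h => by have := hz.1; omega⟩

theorem isSub_comparable {L : ℕ} {u : T.Pos} (h : L ≤ T.len u) :
    IsSub (T.comparable L u) (T.anc u L) := by
  refine isSub_avoid (fun hh => hh.2 (by rw [len_anc h])) fun y hy => ?_
  obtain ⟨z, hz, hzu⟩ := exists_child_anc u y fun hl =>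
    not_not.1 fun hne => not_mem_of_mem_avoid hy ⟨hl, hne⟩
  exact ⟨z, hz, fun hh => hh.2 (hzu hh.1)⟩

theorem eq_anc_of_mem_comparable {L : ℕ} {u y : T.Pos} (h : y ∈ T.comparable L u)
    (hl : T.len y ≤ T.len u) : y = T.anc u (T.len y) :=
  not_not.1 fun hne => not_mem_of_mem_avoid h ⟨hl, hne⟩

theorem Play.mem_comparable (x : T.Play) {L n m : ℕ} (hn : L ≤ n) (hm : L ≤ m) :
    x.pos m ∈ T.comparable L (x.pos n) := by
  refine ⟨?_, ?_, fun i hi hi' hh => ?_⟩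
  · rwa [x.anc hn, x.len_pos, x.len_pos]
  · rw [x.anc hn, x.len_pos, x.anc hm]
  · rw [x.len_pos] at hi'
    rw [x.anc hi'] at hh
    obtain ⟨h1, h2⟩ := hh
    simp only [x.len_pos] at h1 h2
    exact h2 (x.anc h1).symm

namespace Unravel

variable {O : Set T.Pos} {K : ℕ}

/-- Player `0` commits to a subtree restricting only himself. -/
def GoodI (S : Set T.Pos) (p : T.Pos) : Prop :=
  IsSub S p ∧ ∀ y ∈ S, T.len y % 2 = 1 → ∀ z, T.Child y z → z ∈ S

/-- Player `1` either accepts to reach a position in `O` or commits to a subtree avoiding `O`. -/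
def GoodII (O : Set T.Pos) (S R : Set T.Pos) (q : T.Pos) : Prop :=
  IsSub R q ∧ ((∃ u ∈ O, u ∈ S ∧ T.len q ≤ T.len u ∧ T.anc u (T.len q) = q ∧
      R = T.comparable (T.len q) u) ∨
    ((∀ y ∈ R, y ∉ O) ∧ ∀ y ∈ R, T.len y % 2 = 0 → ∀ z ∈ S, T.Child y z → z ∈ R))

/-- The positions of the auxiliary game. -/
structure Legal (O : Set T.Pos) (K : ℕ) (a : T.Pos × Set T.Pos × Set T.Pos) : Prop where
  fst : T.len a.1 ≤ K → a.2.1 = Set.univ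
  snd : T.len a.1 ≤ K + 1 → a.2.2 = Set.univ
  goodI : K + 1 ≤ T.len a.1 → GoodI a.2.1 (T.anc a.1 (K + 1))
  goodII : K + 2 ≤ T.len a.1 → GoodII O a.2.1 a.2.2 (T.anc a.1 (K + 2))
  mem : K + 2 ≤ T.len a.1 → a.1 ∈ a.2.2

open Classical in
/-- The triple attached to a position once the commitments are `S` and `S'`. -/
noncomputable def triple (K : ℕ) (S S' : Set T.Pos) (p : T.Pos) : T.Pos × Set T.Pos × Set T.Pos :=
  (p, if T.len p ≤ K then Set.univ else S, if T.len p ≤ K + 1 then Set.univ else S')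

theorem Legal.triple_eq {a : T.Pos × Set T.Pos × Set T.Pos} (h : Legal O K a) :
    triple K a.2.1 a.2.2 a.1 = a := by
  obtain ⟨p, S, S'⟩ := a
  have h1 := h.fst
  have h2 := h.snd
  simp only [triple, Prod.mk.injEq, true_and] at *
  exact ⟨by split_ifs with hh; exacts [(h1 hh).symm, rfl],
    by split_ifs with hh; exacts [(h2 hh).symm, rfl]⟩

theorem legal_triple {S S' : Set T.Pos} {p : T.Pos}
    (hI : K + 1 ≤ T.len p → GoodI S (T.anc p (K + 1)))
    (hII : K + 2 ≤ T.len p → GoodII O S S' (T.anc p (K + 2)) ∧ p ∈ S') :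
    Legal O K (triple K S S' p) where
  fst h := if_pos h
  snd h := if_pos h
  goodI h := by
    simp only [triple] at h ⊢
    rw [if_neg (by omega)]; exact hI h
  goodII h := by
    simp only [triple] at h ⊢
    rw [if_neg (by omega), if_neg (by omega)]; exact (hII h).1
  mem h := by
    simp only [triple] at h ⊢
    rw [if_neg (by omega)]; exact (hII h).2

theorem legal_univ {p : T.Pos} (h : T.len p ≤ K) : Legal O K (p, Set.univ, Set.univ) where
  fst _ := rfl
  snd _ := rfl
  goodI h' := by simp only at h'; omega
  goodII h' := by simp only at h'; omega
  mem h' := by simp only at h'; omega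

theorem Legal.par {a : T.Pos × Set T.Pos × Set T.Pos} (h : Legal O K a) :
    Legal O K (triple K a.2.1 a.2.2 (T.par a.1)) := by
  have hl := T.len_par a.1
  refine legal_triple (fun h' => ?_) (fun h' => ?_)
  · rw [anc_par (by omega)]; exact h.goodI (by omega)
  · rw [anc_par (by omega)]
    refine ⟨h.goodII (by omega), ?_⟩
    have h1 := h.goodII (by omega)
    rcases h1.1.par_mem _ (h.mem (by omega)) with h2 | h2
    · have := len_anc (p := a.1) (m := K + 2) (by omega)
      rw [← h2] at this; omega
    · exact h2.2

theorem exists_legal_child {a : T.Pos × Set T.Pos × Set T.Pos} (h : Legal O K a) :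
    ∃ p S S', T.Child a.1 p ∧ Legal O K (triple K S S' p) ∧ triple K S S' a.1 = a := by
  obtain ⟨p, S, S'⟩ := a
  obtain ⟨q, hq⟩ := T.exists_child p
  have hlq := hq.1
  rcases lt_trichotomy (T.len p) K with hp | hp | hp
  · exact ⟨q, S, S', hq, legal_triple (fun _ => by omega) (fun _ => by omega), h.triple_eq⟩
  · refine ⟨q, T.avoid ∅ q, Set.univ, hq, legal_triple (fun _ => ?_) (fun _ => by omega), ?_⟩
    · rw [anc_of_le (by omega)]
      refine ⟨isSub_avoid (by simp) fun y _ => ?_,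
        fun y hy _ z hz => child_mem_avoid hy hz (by simp)⟩
      obtain ⟨z, hz⟩ := T.exists_child y
      exact ⟨z, hz, by simp⟩
    · have h1 := h.fst hp.le
      have h2 := h.snd (by simp only; omega)
      simp only at h1 h2
      simp [triple, hp, h1, h2]
  rcases (Nat.succ_le_iff.2 hp).eq_or_lt with hp | hp
  · have h2 := h.snd hp.ge
    have hI := h.goodI hp.le
    simp only at h2 hI
    have hpe : T.anc p (K + 1) = p := anc_of_le hp.ge
    rw [hpe] at hI
    have eq : ∀ S'', triple K S S'' p = (p, S, S') := fun S'' => by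
      simp only [triple, h2]
      rw [if_neg (by omega), if_pos (by omega)]
    by_cases hO : ∃ u ∈ O, u ∈ S ∧ K + 2 ≤ T.len u
    · obtain ⟨u, hu, huS, hul⟩ := hO
      have hlu : T.len (T.anc u (K + 2)) = K + 2 := len_anc hul
      have hup : T.anc u (K + 1) = p := by
        have := hI.1.anc_eq huS
        rwa [← hp] at this
      refine ⟨T.anc u (K + 2), S, T.comparable (K + 2) u, ?_, legal_triple (fun _ => ?_)
        (fun _ => ?_), eq _⟩
      · have := anc_child (p := u) (m := K + 1) (by omega)
        rwa [hup] at this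
      · rw [anc_anc (by omega), hup]; exact hI
      · rw [anc_of_le hlu.le]
        exact ⟨⟨isSub_comparable hul, .inl ⟨u, hu, huS, by rwa [hlu], by rw [hlu], by rw [hlu]⟩⟩,
          (isSub_comparable hul).mem⟩
    · obtain ⟨q, hqS, hq⟩ := hI.1.exists_child p hI.1.mem
      have hlq := hq.1
      have hsub : IsSub (T.avoid Sᶜ q) q := by
        refine isSub_avoid (by simpa) fun y hy => ?_
        obtain ⟨z, hzS, hz⟩ := hI.1.exists_child y (not_not.1 (not_mem_of_mem_avoid hy))
        exact ⟨z, hz, by simpa⟩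
      refine ⟨q, S, T.avoid Sᶜ q, hq, legal_triple (fun _ => ?_) (fun _ => ?_), eq _⟩
      · rw [hq.anc (by omega), hpe]; exact hI
      · rw [anc_of_le (by omega)]
        refine ⟨⟨hsub, .inr ⟨fun y hy hyO => hO ⟨y, hyO, not_not.1 (not_mem_of_mem_avoid hy), ?_⟩,
          fun y hy _ z hzS hz => child_mem_avoid hy hz (by simpa)⟩⟩, hsub.mem⟩
        have := hy.1; omega
  · replace hp : K + 2 ≤ T.len p := hp
    obtain ⟨z, hz, hpz⟩ := (h.goodII hp).1.exists_child p (h.mem hp)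
    refine ⟨z, S, S', hpz, legal_triple (fun _ => ?_) (fun _ => ?_), h.triple_eq⟩
    · rw [hpz.anc (by omega)]; exact h.goodI (by simp only; omega)
    · rw [hpz.anc (by omega)]; exact ⟨h.goodII hp, hz⟩

theorem triple_triple {S S' : Set T.Pos} {p q : T.Pos} (h : T.len q ≤ T.len p) :
    triple K (triple K S S' p).2.1 (triple K S S' p).2.2 q = triple K S S' q := by
  simp only [triple, Prod.mk.injEq, true_and]
  constructor
  · by_cases h1 : T.len q ≤ K
    · rw [if_pos h1, if_pos h1]
    · rw [if_neg h1, if_neg h1, if_neg (by omega)]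
  · by_cases h1 : T.len q ≤ K + 1
    · rw [if_pos h1, if_pos h1]
    · rw [if_neg h1, if_neg h1, if_neg (by omega)]

/-- The auxiliary game unraveling the open set of plays entering `O`. -/
noncomputable def tree (O : Set T.Pos) (K : ℕ) : GameTree where
  Pos := {a : T.Pos × Set T.Pos × Set T.Pos // Legal O K a}
  len a := T.len a.1.1
  par a := ⟨_, a.2.par⟩
  len_par a := T.len_par a.1.1
  exists_child := by
    rintro ⟨a, ha⟩
    obtain ⟨p, S, S', hp, hl, e⟩ := exists_legal_child ha
    refine ⟨⟨_, hl⟩, hp.1, Subtype.ext ?_⟩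
    have := T.len_par p
    change triple K (triple K S S' p).2.1 (triple K S S' p).2.2 (T.par p) = a
    rw [triple_triple (by omega), hp.2, e]

/-- The play of the auxiliary game with commitments `S` and `S'` over the play `x`. -/
noncomputable def raise (x : T.Play) (S S' : Set T.Pos) (hI : GoodI S (x.pos (K + 1)))
    (hII : GoodII O S S' (x.pos (K + 2))) (hm : ∀ m, K + 2 ≤ m → x.pos m ∈ S') :
    (tree O K).Play where
  pos n := ⟨triple K S S' (x.pos n), by
    refine legal_triple (fun h => ?_) (fun h => ?_) <;> rw [x.len_pos] at h <;> rw [x.anc h]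
    exacts [hI, ⟨hII, hm n h⟩]⟩
  len_pos n := x.len_pos n
  par_pos n := Subtype.ext (by
    change triple K (triple K S S' (x.pos (n + 1))).2.1 (triple K S S' (x.pos (n + 1))).2.2
      (T.par (x.pos (n + 1))) = _
    have := T.len_par (x.pos (n + 1))
    rw [triple_triple (by omega), x.par_pos])

open Classical in
/-- The move of `s` at a triple. -/
noncomputable def app (s : (tree O K).Strat) (a : T.Pos × Set T.Pos × Set T.Pos) :
    T.Pos × Set T.Pos × Set T.Pos :=
  if h : Legal O K a then (s.mv ⟨a, h⟩).1 else a

theorem app_of_legal (s : (tree O K).Strat) {a : T.Pos × Set T.Pos × Set T.Pos}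
    (h : Legal O K a) : app s a = (s.mv ⟨a, h⟩).1 := dif_pos h

theorem app_congr {s s' : (tree O K).Strat} {n : ℕ}
    (h : ∀ p, (tree O K).len p < n → s.mv p = s'.mv p) {a : T.Pos × Set T.Pos × Set T.Pos}
    (ha : T.len a.1 < n) : app s a = app s' a := by
  unfold app
  split_ifs with h'
  · rw [h ⟨a, h'⟩ ha]
  · rfl

variable {s : (tree O K).Strat} {a : T.Pos × Set T.Pos × Set T.Pos}

theorem legal_app (h : Legal O K a) : Legal O K (app s a) := by
  rw [app_of_legal s h]; exact (s.mv _).2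

theorem child_app (h : Legal O K a) : T.Child a.1 (app s a).1 := by
  rw [app_of_legal s h]
  exact ⟨(s.child ⟨a, h⟩).1, congrArg (fun b => b.1.1) (s.child ⟨a, h⟩).2⟩

theorem triple_app (h : Legal O K a) :
    triple K (app s a).2.1 (app s a).2.2 a.1 = a := by
  have h1 := congrArg Subtype.val (s.child ⟨a, h⟩).2
  have h2 := (child_app (s := s) h).2
  rw [app_of_legal s h] at h2 ⊢
  rwa [← h2]

theorem app_fst (h : Legal O K a) (hl : K + 1 ≤ T.len a.1) : (app s a).2.1 = a.2.1 := by
  have := congrArg (fun b => b.2.1) (triple_app (s := s) h)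
  simpa only [triple, if_neg (show ¬ T.len a.1 ≤ K by omega)] using this

theorem app_snd (h : Legal O K a) (hl : K + 2 ≤ T.len a.1) : (app s a).2.2 = a.2.2 := by
  have := congrArg (fun b => b.2.2) (triple_app (s := s) h)
  simpa only [triple, if_neg (show ¬ T.len a.1 ≤ K + 1 by omega)] using this

theorem followsFrom_raise {j : ℕ} {x : T.Play} {S S' : Set T.Pos}
    (hI : GoodI S (x.pos (K + 1))) (hII : GoodII O S S' (x.pos (K + 2)))
    (hm : ∀ m, K + 2 ≤ m → x.pos m ∈ S')
    (hlt : ∀ n ≤ K, n % 2 = j → x.pos (n + 1) = (app s (x.pos n, Set.univ, Set.univ)).1)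
    (hK : K % 2 = j → (app s (x.pos K, Set.univ, Set.univ)).2.1 = S)
    (hK1 : (K + 1) % 2 = j → x.pos (K + 2) = (app s (x.pos (K + 1), S, Set.univ)).1 ∧
      (app s (x.pos (K + 1), S, Set.univ)).2.2 = S')
    (hge : ∀ n, K + 2 ≤ n → n % 2 = j → x.pos (n + 1) = (app s (x.pos n, S, S')).1) :
    FollowsFrom j s 0 (raise x S S' hI hII hm) := by
  intro n _ hj
  refine Subtype.ext ?_
  have hl := ((raise x S S' hI hII hm).pos n).2
  have e : (s.mv ((raise x S S' hI hII hm).pos n)).1 = app s (triple K S S' (x.pos n)) :=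
    (app_of_legal s hl).symm
  rw [e]
  change triple K S S' (x.pos (n + 1)) = _
  have hl' : Legal O K (triple K S S' (x.pos n)) := hl
  have hleg := legal_app (s := s) hl'
  have hc := (child_app (s := s) hl').1
  have h1 := hleg.fst
  have h2 := hleg.snd
  have h3 := app_fst (s := s) hl'
  have h4 := app_snd (s := s) hl'
  simp only [triple, x.len_pos] at *
  refine Prod.ext ?_ (Prod.ext ?_ ?_) <;> simp only
  · rcases lt_trichotomy n (K + 1) with h | rfl | h
    · rw [if_pos (by omega), if_pos (by omega)]; exact hlt n (by omega) hj
    · rw [if_neg (by omega), if_pos le_rfl]; exact (hK1 hj).1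
    · rw [if_neg (by omega), if_neg (by omega)]; exact hge n (by omega) hj
  · rcases lt_trichotomy n K with h | rfl | h
    · rw [if_pos (by omega), h1 (by omega)]
    · simpa using (hK hj).symm
    · rw [if_neg (by omega), h3 (by omega), if_neg (by omega)]
  · rcases lt_trichotomy n (K + 1) with h | rfl | h
    · rw [if_pos (by omega), h2 (by omega)]
    · simpa using (hK1 hj).2.symm
    · rw [if_neg (by omega), h4 (by omega), if_neg (by omega)]

end Unravel
end GameTree

namespace GameTree.Unravel

variable {T : GameTree} {O : Set T.Pos} {K : ℕ}

/-- The subtree proposed by player `0` below the ancestor of `p` at level `K`. -/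
noncomputable def offer (s : (tree O K).Strat) (p : T.Pos) : Set T.Pos :=
  (app s (T.anc p K, Set.univ, Set.univ)).2.1

/-- The positions in `O` allowed by the subtree proposed by player `0`. -/
def target₀ (s : (tree O K).Strat) : Set T.Pos := {u | u ∈ O ∧ u ∈ offer s u}

/-- The positions excluded while player `0` cannot force a position in `O`. -/
def bad₀ (s : (tree O K).Strat) : Set T.Pos := {z | Force 0 (target₀ s) z ∨ z ∉ offer s z}

/-- The strategy for player `0` induced by one in the auxiliary game. -/
noncomputable def strat₀ (s : (tree O K).Strat) : T.Strat :=
  T.legalize fun p =>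
    if T.len p ≤ K + 1 then (app s (T.anc p K, Set.univ, Set.univ)).1
    else (phase 0 (K + 2) (target₀ s)
      (fun u => T.legalize fun p => (app s (p, offer s p, T.comparable (K + 2) u)).1)
      (T.legalize fun p =>
        (app s (p, offer s p, T.avoid (bad₀ s) (T.anc p (K + 2)))).1)).mv p

/-- In the auxiliary game, player `1` answers the subtree `S` by accepting to reach `u`. -/
def Accepts (s : (tree O K).Strat) (u : T.Pos) (S : Set T.Pos) : Prop :=
  u ∈ O ∧ u ∈ S ∧ K + 2 ≤ T.len u ∧ GoodI S (T.anc u (K + 1)) ∧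
    app s (T.anc u (K + 1), S, Set.univ) = (T.anc u (K + 2), S, T.comparable (K + 2) u)

/-- The positions that player `1` accepts for some proposed subtree. -/
def target₁ (s : (tree O K).Strat) : Set T.Pos := {u | ∃ S, Accepts s u S}

open Classical in
/-- A subtree for which player `1` accepts `u`. -/
noncomputable def accepted (s : (tree O K).Strat) (u : T.Pos) : Set T.Pos :=
  if h : ∃ S, Accepts s u S then h.choose else Set.univ

/-- The subtree of positions from which player `1` cannot force an accepted position. -/
def safe₁ (s : (tree O K).Strat) (p : T.Pos) : Set T.Pos :=
  T.avoid {z | Force 1 (target₁ s) z} (T.anc p (K + 1))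

/-- The strategy for player `1` induced by one in the auxiliary game. -/
noncomputable def strat₁ (s : (tree O K).Strat) : T.Strat :=
  T.legalize fun p =>
    if T.len p ≤ K then (app s (p, Set.univ, Set.univ)).1
    else (phase 1 (K + 1) (target₁ s)
      (fun u => T.legalize fun p => (app s (p, accepted s u, T.comparable (K + 2) u)).1)
      (T.legalize fun p => if T.len p = K + 1 then (app s (p, safe₁ s p, Set.univ)).1 else
        (app s (p, safe₁ s p, (app s (T.anc p (K + 1), safe₁ s p, Set.univ)).2.2)).1)).mv p

theorem strat₀_congr {s s' : (tree O K).Strat} {n : ℕ}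
    (h : ∀ p, (tree O K).len p < n → s.mv p = s'.mv p) {p : T.Pos} (hp : T.len p < n) :
    (strat₀ s).mv p = (strat₀ s').mv p := by
  apply legalize_congr
  have happ : ∀ q S S', T.len q ≤ T.len p → app s (q, S, S') = app s' (q, S, S') :=
    fun q S S' hq => app_congr h (lt_of_le_of_lt hq hp)
  by_cases hl : T.len p ≤ K + 1
  · rw [if_pos hl, if_pos hl, happ]
    rcases le_total K (T.len p) with h | h
    · rwa [len_anc h]
    · rw [anc_of_le h]
  · rw [if_neg hl, if_neg hl]
    have hoff : offer s = offer s' := by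
      funext q
      unfold offer
      rcases le_total K (T.len q) with h | h
      · rw [happ _ _ _ (by rw [len_anc h]; omega)]
      · rw [happ _ _ _ (by rw [anc_of_le h]; omega)]
    have ht : target₀ s = target₀ s' := by simp only [target₀, hoff]
    have hb : bad₀ s = bad₀ s' := by simp only [bad₀, hoff, ht]
    refine phase_congr ht (fun u => legalize_congr ?_) (legalize_congr ?_)
    · rw [hoff, happ _ _ _ le_rfl]
    · rw [hoff, hb, happ _ _ _ le_rfl]

theorem strat₁_congr {s s' : (tree O K).Strat} {n : ℕ}
    (h : ∀ p, (tree O K).len p < n → s.mv p = s'.mv p) {p : T.Pos} (hp : T.len p < n) :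
    (strat₁ s).mv p = (strat₁ s').mv p := by
  apply legalize_congr
  have happ : ∀ q S S', T.len q ≤ T.len p → app s (q, S, S') = app s' (q, S, S') :=
    fun q S S' hq => app_congr h (lt_of_le_of_lt hq hp)
  by_cases hl : T.len p ≤ K
  · rw [if_pos hl, if_pos hl, happ _ _ _ le_rfl]
  · rw [if_neg hl, if_neg hl]
    have hacc : Accepts s = Accepts s' := by
      funext u S
      unfold Accepts
      by_cases hu : K + 2 ≤ T.len u
      · rw [happ _ _ _ (by rw [len_anc (by omega)]; omega)]
      · simp [hu]
    have ht : target₁ s = target₁ s' := by simp only [target₁, hacc]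
    have ha : accepted s = accepted s' := by
      funext u; unfold accepted; rw [hacc]
    have hs : safe₁ s = safe₁ s' := by funext u; simp only [safe₁, ht]
    refine phase_congr ht (fun u => legalize_congr ?_) (legalize_congr ?_)
    · rw [ha, happ _ _ _ le_rfl]
    · rw [hs, happ _ _ _ le_rfl, happ (T.anc p _) _ _ (by rw [len_anc (by omega)]; omega),
        happ _ _ _ le_rfl]

theorem legal_of {p : T.Pos} {S S' : Set T.Pos} (hl : K + 2 ≤ T.len p)
    (hI : GoodI S (T.anc p (K + 1))) (hII : GoodII O S S' (T.anc p (K + 2))) (hm : p ∈ S') :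
    Legal O K (p, S, S') where
  fst h := by simp only at h; omega
  snd h := by simp only at h; omega
  goodI _ := hI
  goodII _ := hII
  mem _ := hm

theorem legal_of_eq {p : T.Pos} {S : Set T.Pos} (hl : T.len p = K + 1) (hI : GoodI S p) :
    Legal O K (p, S, Set.univ) where
  fst h := by simp only at h; omega
  snd _ := rfl
  goodI _ := by rwa [anc_of_le (by simp only; omega)]
  goodII h := by simp only at h; omega
  mem h := by simp only at h; omega

theorem goodII_comparable {S : Set T.Pos} {u : T.Pos} (hu : u ∈ O) (huS : u ∈ S)
    (hl : K + 2 ≤ T.len u) : GoodII O S (T.comparable (K + 2) u) (T.anc u (K + 2)) := by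
  have hlu : T.len (T.anc u (K + 2)) = K + 2 := len_anc hl
  exact ⟨isSub_comparable hl, .inl ⟨u, hu, huS, by rwa [hlu], by rw [hlu], by rw [hlu]⟩⟩

/-- Following a position in `O` in the auxiliary game after an acceptance. -/
theorem move_eq_of_comparable {s : (tree O K).Strat} {x : T.Play} {S : Set T.Pos} {n m : ℕ}
    (hI : GoodI S (x.pos (K + 1))) (hn : K + 2 ≤ n) (hm : K + 2 ≤ m)
    (hu : x.pos n ∈ O) (huS : x.pos n ∈ S)
    (hge : n ≤ m → T.Child (x.pos m) (app s (x.pos m, S, T.comparable (K + 2) (x.pos n))).1 →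
      x.pos (m + 1) = (app s (x.pos m, S, T.comparable (K + 2) (x.pos n))).1) :
    x.pos (m + 1) = (app s (x.pos m, S, T.comparable (K + 2) (x.pos n))).1 := by
  have hII := goodII_comparable hu huS (by rw [x.len_pos]; exact hn)
  rw [x.anc hn] at hII
  have hleg : Legal O K (x.pos m, S, T.comparable (K + 2) (x.pos n)) := by
    refine legal_of (by rw [x.len_pos]; exact hm) ?_ ?_ (x.mem_comparable hn hm)
    · rw [x.anc (by omega)]; exact hI
    · rw [x.anc (by omega)]; exact hII
  have hc := child_app (s := s) hleg
  rcases Nat.lt_or_ge m n with h | h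
  · have h1 := (legal_app (s := s) hleg).mem (by rw [hc.1]; simp only [x.len_pos]; omega)
    rw [app_snd hleg (by simp only [x.len_pos]; omega)] at h1
    have hl : T.len (app s (x.pos m, S, T.comparable (K + 2) (x.pos n))).1 = m + 1 := by
      rw [hc.1]; simp only [x.len_pos]
    have := eq_anc_of_mem_comparable h1 (by rw [hl, x.len_pos]; omega)
    rw [this, hl, x.anc h]
  · exact hge h hc

theorem lift₀ (hK : K % 2 = 0) (s : (tree O K).Strat) {x : T.Play}
    (hx : FollowsFrom 0 (strat₀ s) 0 x) :
    ∃ y : (tree O K).Play, FollowsFrom 0 s 0 y ∧ ∀ n, (y.pos n).1.1 = x.pos n := by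
  have hunivK : Legal O K (x.pos K, Set.univ, Set.univ) := legal_univ (x.len_pos K).le
  have hlow : ∀ n ≤ K, n % 2 = 0 →
      x.pos (n + 1) = (app s (x.pos n, Set.univ, Set.univ)).1 := by
    intro n hn hj
    have e : T.anc (x.pos n) K = x.pos n := anc_of_le (by rwa [x.len_pos])
    have hl : T.len (x.pos n) ≤ K + 1 := by rw [x.len_pos]; omega
    rw [hx n (Nat.zero_le _) hj, strat₀, legalize_mv] <;> rw [if_pos hl, e]
    exact child_app (s := s) (legal_univ ((x.len_pos n).trans_le hn))
  set S := (app s (x.pos K, Set.univ, Set.univ)).2.1 with hS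
  have hoffer : ∀ m, K ≤ m → offer s (x.pos m) = S := fun m hm => by rw [offer, x.anc hm]
  have hI : GoodI S (x.pos (K + 1)) := by
    have h1 := (legal_app (s := s) hunivK).goodI
    rw [← hlow K le_rfl hK, x.len_pos, anc_of_le (x.len_pos _).le] at h1
    exact h1 le_rfl
  have hphase : FollowsFrom 0 (phase 0 (K + 2) (target₀ s)
      (fun u => T.legalize fun p => (app s (p, offer s p, T.comparable (K + 2) u)).1)
      (T.legalize fun p => (app s (p, offer s p, T.avoid (bad₀ s) (T.anc p (K + 2)))).1))
      (K + 2) x := by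
    intro n hn hj
    have hl : ¬ T.len (x.pos n) ≤ K + 1 := by rw [x.len_pos]; omega
    rw [hx n (Nat.zero_le _) hj, strat₀, legalize_mv] <;> rw [if_neg hl]
    exact Strat.child _ _
  rcases phase_spec hphase with ⟨n, hn, ⟨hnO, hnS⟩, hf⟩ | ⟨hnF, hf⟩
  · rw [hoffer n (by omega)] at hnS
    have hII := goodII_comparable hnO hnS (by rw [x.len_pos]; exact hn)
    rw [x.anc hn] at hII
    refine ⟨raise x S _ hI hII fun m hm => x.mem_comparable hn hm,
      followsFrom_raise _ _ _ hlow (fun _ => rfl) (fun h => by omega) fun m hm hj =>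
        move_eq_of_comparable hI hn hm hnO hnS fun hle hc => ?_, fun _ => rfl⟩
    rw [hf m hle hj]
    rw [legalize_mv] <;> rw [hoffer m (by omega)]
    exact hc
  · have hmem2 : x.pos (K + 2) ∈ S :=
      hI.2 _ hI.1.mem (by rw [x.len_pos]; omega) _ (x.child _)
    have hSl : ∀ y ∈ T.avoid (bad₀ s) (x.pos (K + 2)), offer s y = S := by
      intro y hy
      have h1 := hy.2.1
      rw [x.len_pos] at h1
      rw [offer, ← anc_anc (show K ≤ K + 2 by omega), h1, x.anc (by omega)]
    have hSc : ∀ y ∈ T.avoid (bad₀ s) (x.pos (K + 2)), ∀ z, T.Child y z → offer s z = S := by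
      intro y hy z hz
      have h1 := hy.1
      rw [x.len_pos] at h1
      rw [offer, hz.anc (by omega)]
      exact hSl y hy
    have hnb : ∀ y ∈ T.avoid (bad₀ s) (x.pos (K + 2)), ¬ Force 0 (target₀ s) y ∧ y ∈ S := by
      intro y hy
      have := not_mem_of_mem_avoid hy
      simp only [bad₀, Set.mem_ofPred_eq, not_or, not_not] at this
      rwa [hSl y hy] at this
    have hroot : x.pos (K + 2) ∉ bad₀ s := by
      simp only [bad₀, Set.mem_ofPred_eq, not_or, not_not]
      rw [hoffer _ (by omega)]
      exact ⟨hnF _ le_rfl, hmem2⟩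
    have hchild : ∀ y ∈ T.avoid (bad₀ s) (x.pos (K + 2)), ∀ z, T.Child y z → z ∈ S →
        ¬ Force 0 (target₀ s) z → z ∈ T.avoid (bad₀ s) (x.pos (K + 2)) := by
      intro y hy z hz hzS hzF
      refine child_mem_avoid hy hz ?_
      simp only [bad₀, Set.mem_ofPred_eq, not_or, not_not]
      rw [hSc y hy z hz]
      exact ⟨hzF, hzS⟩
    have hsub : IsSub (T.avoid (bad₀ s) (x.pos (K + 2))) (x.pos (K + 2)) := by
      refine isSub_avoid hroot fun y hy => ?_
      obtain ⟨hyF, hyS⟩ := hnb y hy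
      rcases Nat.mod_two_eq_zero_or_one (T.len y) with hj | hj
      · obtain ⟨z, hzS, hz⟩ := hI.1.exists_child y hyS
        exact ⟨z, hz, not_mem_of_mem_avoid
          (hchild y hy z hz hzS fun h => hyF (Force.of_child hj hz h))⟩
      · by_contra! hcon
        refine hyF (Force.of_forall_child fun z hz => ?_)
        by_contra hzF
        exact not_mem_of_mem_avoid (hchild y hy z hz (hI.2 y hyS hj z hz) hzF) (hcon z hz)
    have hII : GoodII O S (T.avoid (bad₀ s) (x.pos (K + 2))) (x.pos (K + 2)) := by
      refine ⟨hsub, .inr ⟨fun y hy hyO => ?_, fun y hy hj z hzS hz => ?_⟩⟩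
      · exact (hnb y hy).1 (force_of_mem ⟨hyO, by rw [hSl y hy]; exact (hnb y hy).2⟩)
      · exact hchild y hy z hz hzS fun h => (hnb y hy).1 (Force.of_child hj hz h)
    have hleg : ∀ m, K + 2 ≤ m → x.pos m ∈ T.avoid (bad₀ s) (x.pos (K + 2)) →
        Legal O K (x.pos m, S, T.avoid (bad₀ s) (x.pos (K + 2))) := by
      intro m hm hmem
      refine legal_of (by rw [x.len_pos]; exact hm) ?_ ?_ hmem
      · rw [x.anc (by omega)]; exact hI
      · rw [x.anc (by omega)]; exact hII
    have hmove : ∀ m, K + 2 ≤ m → m % 2 = 0 → x.pos m ∈ T.avoid (bad₀ s) (x.pos (K + 2)) →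
        x.pos (m + 1) = (app s (x.pos m, S, T.avoid (bad₀ s) (x.pos (K + 2)))).1 := by
      intro m hm hj hmem
      rw [hf m hm hj, legalize_mv] <;> rw [hoffer m (by omega), x.anc hm]
      exact child_app (s := s) (hleg m hm hmem)
    have hm : ∀ m, K + 2 ≤ m → x.pos m ∈ T.avoid (bad₀ s) (x.pos (K + 2)) := by
      intro m hm
      induction m, hm using Nat.le_induction with
      | base => exact hsub.mem
      | succ m hm ih =>
        rcases Nat.mod_two_eq_zero_or_one m with hj | hj
        · have hl := hleg m hm ih
          have h1 := (legal_app (s := s) hl).mem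
          rw [app_snd hl (by simp only [x.len_pos]; omega), ← hmove m hm hj ih, x.len_pos] at h1
          exact h1 (by omega)
        · exact hchild _ ih _ (x.child m)
            (hI.2 _ (hnb _ ih).2 (by rwa [x.len_pos]) _ (x.child m)) (hnF _ (by omega))
    exact ⟨raise x S _ hI hII hm, followsFrom_raise _ _ _ hlow (fun _ => rfl)
      (fun h => by omega) fun m h hj => hmove m h hj (hm m h), fun _ => rfl⟩

theorem lift₁ (hK : K % 2 = 0) (s : (tree O K).Strat) {x : T.Play}
    (hx : FollowsFrom 1 (strat₁ s) 0 x) :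
    ∃ y : (tree O K).Play, FollowsFrom 1 s 0 y ∧ ∀ n, (y.pos n).1.1 = x.pos n := by
  have hlow : ∀ n ≤ K, n % 2 = 1 →
      x.pos (n + 1) = (app s (x.pos n, Set.univ, Set.univ)).1 := by
    intro n hn hj
    have hl : T.len (x.pos n) ≤ K := by rwa [x.len_pos]
    rw [hx n (Nat.zero_le _) hj, strat₁, legalize_mv] <;> rw [if_pos hl]
    exact child_app (s := s) (legal_univ ((x.len_pos n).trans_le hn))
  have hphase : FollowsFrom 1 (phase 1 (K + 1) (target₁ s)
      (fun u => T.legalize fun p => (app s (p, accepted s u, T.comparable (K + 2) u)).1)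
      (T.legalize fun p => if T.len p = K + 1 then (app s (p, safe₁ s p, Set.univ)).1 else
        (app s (p, safe₁ s p, (app s (T.anc p (K + 1), safe₁ s p, Set.univ)).2.2)).1))
      (K + 1) x := by
    intro n hn hj
    have hl : ¬ T.len (x.pos n) ≤ K := by rw [x.len_pos]; omega
    rw [hx n (Nat.zero_le _) hj, strat₁, legalize_mv] <;> rw [if_neg hl]
    exact Strat.child _ _
  rcases phase_spec hphase with ⟨n, -, hnU, hf⟩ | ⟨hnF, hf⟩
  · have hacc : Accepts s (x.pos n) (accepted s (x.pos n)) := by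
      have hnU' : ∃ S, Accepts s (x.pos n) S := hnU
      rw [accepted, dif_pos hnU']
      exact hnU'.choose_spec
    set S := accepted s (x.pos n)
    obtain ⟨hnO, hnS, hn, hI, happ⟩ := hacc
    have hII := goodII_comparable hnO hnS hn
    rw [x.len_pos] at hn
    rw [x.anc hn] at hII
    rw [x.anc (by omega)] at hI
    rw [x.anc hn, x.anc (by omega)] at happ
    refine ⟨raise x S _ hI hII fun m hm => x.mem_comparable hn hm,
      followsFrom_raise _ _ _ hlow (fun h => by omega) (fun _ => by rw [happ]; exact ⟨rfl, rfl⟩)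
        fun m hm hj => move_eq_of_comparable hI hn hm hnO hnS fun hle hc => ?_, fun _ => rfl⟩
    rw [hf m hle hj, legalize_mv hc]
  · set S := T.avoid {z | Force 1 (target₁ s) z} (x.pos (K + 1)) with hS
    have hsafe : ∀ m, K + 1 ≤ m → safe₁ s (x.pos m) = S := fun m hm => by rw [safe₁, x.anc hm]
    have hI : GoodI S (x.pos (K + 1)) := by
      have hch : ∀ y ∈ S, T.len y % 2 = 1 → ∀ z, T.Child y z → z ∈ S := fun y hy hj z hz =>
        child_mem_avoid hy hz fun h => not_mem_of_mem_avoid hy (Force.of_child hj hz h)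
      refine ⟨isSub_avoid (hnF _ le_rfl) fun y hy => ?_, hch⟩
      by_contra! hcon
      exact not_mem_of_mem_avoid hy (Force.of_forall_child hcon)
    have hl1 : Legal O K (x.pos (K + 1), S, Set.univ) := legal_of_eq (x.len_pos _) hI
    have hmove1 : x.pos (K + 2) = (app s (x.pos (K + 1), S, Set.univ)).1 := by
      have hl : T.len (x.pos (K + 1)) = K + 1 := x.len_pos _
      rw [hf (K + 1) le_rfl (by omega), legalize_mv] <;> rw [if_pos hl, hsafe _ le_rfl]
      exact child_app (s := s) hl1
    set S' := (app s (x.pos (K + 1), S, Set.univ)).2.2 with hS'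
    have hfst : (app s (x.pos (K + 1), S, Set.univ)).2.1 = S := app_fst hl1 (x.len_pos _).ge
    have hII : GoodII O S S' (x.pos (K + 2)) := by
      have h1 := (legal_app (s := s) hl1).goodII
      rw [hfst, ← hmove1, x.len_pos, anc_of_le (x.len_pos _).le] at h1
      exact h1 le_rfl
    obtain ⟨hsub, hopt⟩ := id hII
    have hkey : (∀ y ∈ S', y ∉ O) ∧
        ∀ y ∈ S', T.len y % 2 = 0 → ∀ z ∈ S, T.Child y z → z ∈ S' := by
      refine hopt.resolve_left ?_
      rintro ⟨u, huO, huS, hul, hanc, hcmp⟩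
      rw [x.len_pos] at hul hanc hcmp
      have hanc1 : T.anc u (K + 1) = x.pos (K + 1) := by
        have := hI.1.anc_eq huS
        rwa [x.len_pos] at this
      refine not_mem_of_mem_avoid huS (force_of_mem ⟨S, huO, huS, hul, ?_, ?_⟩)
      · rwa [hanc1]
      · rw [hanc1, hanc, ← hcmp]
        exact Prod.ext hmove1.symm (Prod.ext hfst rfl)
    have hxS : ∀ m, K + 1 ≤ m → x.pos m ∈ S := by
      intro m hm
      refine ⟨by rw [x.len_pos, x.len_pos]; exact hm, by rw [x.len_pos, x.anc hm],
        fun i hi hi' => ?_⟩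
      rw [x.len_pos] at hi hi'
      rw [x.anc hi']
      exact hnF i hi
    have hleg : ∀ m, K + 2 ≤ m → x.pos m ∈ S' → Legal O K (x.pos m, S, S') := by
      intro m hm hmem
      refine legal_of (by rw [x.len_pos]; exact hm) ?_ ?_ hmem
      · rw [x.anc (by omega)]; exact hI
      · rw [x.anc (by omega)]; exact hII
    have hmove : ∀ m, K + 2 ≤ m → m % 2 = 1 → x.pos m ∈ S' →
        x.pos (m + 1) = (app s (x.pos m, S, S')).1 := by
      intro m hm hj hmem
      have hl : ¬ T.len (x.pos m) = K + 1 := by rw [x.len_pos]; omega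
      rw [hf m (by omega) hj, legalize_mv] <;>
        rw [if_neg hl, hsafe m (by omega), x.anc (by omega)]
      exact child_app (s := s) (hleg m hm hmem)
    have hm : ∀ m, K + 2 ≤ m → x.pos m ∈ S' := by
      intro m hm
      induction m, hm using Nat.le_induction with
      | base => exact hsub.mem
      | succ m hm ih =>
        rcases Nat.mod_two_eq_zero_or_one m with hj | hj
        · exact hkey.2 _ ih (by rwa [x.len_pos]) _ (hxS _ (by omega)) (x.child m)
        · have hl := hleg m hm ih
          have h1 := (legal_app (s := s) hl).mem
          rw [app_snd hl (by simp only [x.len_pos]; omega), ← hmove m hm hj ih, x.len_pos] at h1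
          exact h1 (by omega)
    exact ⟨raise x S S' hI hII hm, followsFrom_raise _ _ _ hlow (fun h => by omega)
      (fun _ => ⟨hmove1, rfl⟩) fun m h hj => hmove m h hj (hm m h), fun _ => rfl⟩

/-- The auxiliary game covers the given one. -/
noncomputable def cover (O : Set T.Pos) {K : ℕ} (hK : K % 2 = 0) : Cover (tree O K) T where
  π a := a.1.1
  len_π _ := rfl
  par_π _ := rfl
  φ j s := if j = 0 then strat₀ s else strat₁ s
  φ_congr j s s' n h p hp := by
    split_ifs
    exacts [strat₀_congr h hp, strat₁_congr h hp]
  lift j hj s x hx := by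
    obtain rfl | rfl : j = 0 ∨ j = 1 := by omega
    exacts [lift₀ hK s hx, lift₁ hK s hx]

theorem cover_isIdUpTo (hK : K % 2 = 0) : (cover O hK).IsIdUpTo K where
  exists_unique p hp := by
    refine ⟨⟨_, legal_univ hp⟩, rfl, ?_⟩
    rintro ⟨⟨q, S, S'⟩, hq⟩ (rfl : q = p)
    have h1 := hq.fst hp
    have h2 := hq.snd (Nat.le_succ_of_le hp)
    simp only at h1 h2
    subst h1 h2
    rfl
  φ_mv j s := by
    rintro ⟨⟨q, S, S'⟩, hq⟩ hl
    change T.len q < K at hl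
    have h1 := hq.fst hl.le
    have h2 := hq.snd (by simp only; omega)
    simp only at h1 h2
    subst h1 h2
    change (if j = 0 then strat₀ s else strat₁ s).mv q = (s.mv _).1.1
    have hc := child_app (s := s) hq
    rw [← congrArg Prod.fst (app_of_legal s hq)]
    split_ifs
    · have e : T.anc q K = q := anc_of_le hl.le
      rw [strat₀, legalize_mv] <;> rw [if_pos (by omega), e]
      exact hc
    · rw [strat₁, legalize_mv] <;> rw [if_pos (by omega)]
      exact hc

end GameTree.Unravel

namespace GameTree

variable {T : GameTree}

/-- Open sets of plays are unraveled. -/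
theorem unravels_of_open (O : Set T.Pos) (hO : ∀ p q, T.Child p q → p ∈ O → q ∈ O) (k : ℕ) :
    Unravels T k {x | ∃ n, x.pos n ∈ O} := by
  have hK : (2 * k) % 2 = 0 := by omega
  refine ⟨_, Unravel.cover O hK, (Unravel.cover_isIdUpTo hK).mono (by omega), 2 * k + 2, ?_⟩
  have key : ∀ x : (Unravel.tree O (2 * k)).Play,
      (Unravel.cover O hK).hom.play x ∈ {x : T.Play | ∃ n, x.pos n ∈ O} ↔
        ∃ y ∈ (x.pos (2 * k + 2)).1.2.2, y ∈ O := by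
    intro x
    set z := (Unravel.cover O hK).hom.play x with hz
    have hpos : ∀ n, (x.pos n).1.1 = z.pos n := fun n => rfl
    have hup : ∀ n m, n ≤ m → z.pos n ∈ O → z.pos m ∈ O := by
      intro n m h hn
      induction m, h using Nat.le_induction with
      | base => exact hn
      | succ m _ ih => exact hO _ _ (z.child _) ih
    have hconst : ∀ m, 2 * k + 2 ≤ m → (x.pos m).1.2.2 = (x.pos (2 * k + 2)).1.2.2 := by
      intro m hm
      induction m, hm using Nat.le_induction with
      | base => rfl
      | succ m hm ih =>
        rw [← ih, ← x.par_pos m]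
        change _ = (Unravel.triple _ _ _ _).2.2
        have hl : T.len (T.par (x.pos (m + 1)).1.1) = m := by
          rw [hpos, z.par_pos, z.len_pos]
        simp only [Unravel.triple, hl]
        rw [if_neg (by omega)]
    have hmem : ∀ m, 2 * k + 2 ≤ m → z.pos m ∈ (x.pos (2 * k + 2)).1.2.2 := by
      intro m hm
      rw [← hconst m hm]
      exact (x.pos m).2.mem (by rw [hpos, z.len_pos]; exact hm)
    have hII := (x.pos (2 * k + 2)).2.goodII (by rw [hpos, z.len_pos])
    rw [hpos, z.anc le_rfl] at hII
    constructor
    · rintro ⟨n, hn⟩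
      exact ⟨z.pos (max n (2 * k + 2)), hmem _ (le_max_right _ _), hup _ _ (le_max_left _ _) hn⟩
    · rintro ⟨y, hy, hyO⟩
      rcases hII.2 with ⟨u, huO, -, hul, -, hS'⟩ | ⟨h, -⟩
      · rw [z.len_pos] at hul hS'
        have h1 := hmem _ hul
        rw [hS'] at h1
        have h2 := eq_anc_of_mem_comparable h1 (by rw [z.len_pos])
        rw [z.len_pos, anc_len] at h2
        exact ⟨_, by rwa [h2]⟩
      · exact absurd hyO (h y hy)
  intro x y hxy
  rw [Set.mem_preimage, Set.mem_preimage, key, key, hxy]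

end GameTree

namespace GameTree

variable {T T' : GameTree}

/-- The identity covering. -/
def Cover.id (T : GameTree) : Cover T T where
  π p := p
  len_π _ := rfl
  par_π _ := rfl
  φ _ s := s
  φ_congr _ _ _ _ h := h
  lift _ _ _ z hz := ⟨z, hz, fun _ => rfl⟩

theorem Unravels.of_decided {B : Set T.Play} {N : ℕ} (h : Decided N B) (k : ℕ) :
    Unravels T k B :=
  ⟨T, Cover.id T, ⟨fun p _ => ⟨p, rfl, fun _ hq => hq⟩, fun _ _ _ _ => rfl⟩, N, h⟩

theorem Unravels.compl {B : Set T.Play} {k : ℕ} (h : Unravels T k B) : Unravels T k Bᶜ := by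
  obtain ⟨T', C, hC, N, hN⟩ := h
  exact ⟨T', C, hC, N, fun _ _ e => not_congr (hN _ _ e)⟩

theorem Decided.preimage {B : Set T.Play} {N : ℕ} (h : Decided N B) (f : Hom T' T) :
    Decided N (f.play ⁻¹' B) :=
  fun _ _ e => h _ _ (congrArg f.map e)

theorem Unravels.iUnion {B : ℕ → Set T.Play}
    (hB : ∀ i (T' : GameTree) (f : Hom T' T) k, Unravels T' k (f.play ⁻¹' B i)) (k : ℕ) :
    Unravels T k (⋃ i, B i) := by
  choose tr C hC N hN using fun i (A : Σ T' : GameTree, Hom T' T) => hB i A.1 A.2 (k + i)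
  let st : ℕ → Σ T' : GameTree, Hom T' T := fun i =>
    Nat.rec ⟨T, Hom.id T⟩ (fun i A => ⟨tr i A, A.2.comp (C i A).hom⟩) i
  let S : ℕ → GameTree := fun i => (st i).1
  let C' : ∀ i, Cover (S (i + 1)) (S i) := fun i => C i (st i)
  have hC' : ∀ i, (C' i).IsIdUpTo (k + i) := fun i => hC i (st i)
  have hbase : ∀ i (p : (limit C' hC').Pos), (st i).2.map ((limitHom C' hC' i).map p) =
      (limitCover C' hC').π p := by
    intro i p
    induction i with
    | zero => rfl
    | succ i ih => rw [← ih]; exact congrArg (st i).2.map (p.2 i)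
  set A : Set (limit C' hC').Play := (limitCover C' hC').hom.play ⁻¹' ⋃ i, B i with hA
  have hdec : ∀ i, Decided (N i (st i)) ((limitCover C' hC').hom.play ⁻¹' B i) := by
    intro i x y e
    have h := (hN i (st i)).preimage (limitHom C' hC' (i + 1)) x y e
    have hp : ∀ x : (limit C' hC').Play, (st i).2.play ((C i (st i)).hom.play
        ((limitHom C' hC' (i + 1)).play x)) = (limitCover C' hC').hom.play x :=
      fun x => Play.ext fun n => hbase (i + 1) (x.pos n)
    simpa only [Set.mem_preimage, hp] using h
  have hopen : Unravels (limit C' hC') k A := by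
    have := unravels_of_open {p : (limit C' hC').Pos | ∀ y : (limit C' hC').Play,
      y.pos ((limit C' hC').len p) = p → y ∈ A} (fun p q hpq hp y hy => hp y (by
        rw [hpq.1] at hy
        rw [← y.par_pos, hy, hpq.2])) k
    convert this using 1
    ext x
    constructor
    · intro hx
      obtain ⟨i, hi⟩ := Set.mem_iUnion.1 hx
      refine ⟨N i (st i), fun y hy => Set.mem_iUnion.2 ⟨i, ?_⟩⟩
      rw [x.len_pos] at hy
      exact (hdec i y x hy).2 hi
    · rintro ⟨n, hn⟩
      exact hn x (by rw [x.len_pos])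
  obtain ⟨T', D, hD, M, hM⟩ := hopen
  exact ⟨T', (limitCover C' hC').comp D, limitCover_isIdUpTo.comp hD, M, hM⟩

/-- The `σ`-algebra of sets of plays that can be unraveled over all homomorphisms. -/
instance (T : GameTree) : MeasurableSpace T.Play where
  MeasurableSet' B := ∀ (T' : GameTree) (f : Hom T' T) k, Unravels T' k (f.play ⁻¹' B)
  measurableSet_empty _ _ k := Unravels.of_decided (N := 0) (fun _ _ _ => Iff.rfl) k
  measurableSet_compl _ h T' f k := (h T' f k).compl
  measurableSet_iUnion B h T' f k := by
    rw [Set.preimage_iUnion]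
    exact Unravels.iUnion (B := fun i => f.play ⁻¹' B i) (fun i T'' g k => h i T'' (f.comp g) k) k

theorem Decided.measurableSet {B : Set T.Play} {N : ℕ} (h : Decided N B) : MeasurableSet B :=
  fun _ f k => Unravels.of_decided (h.preimage f) k

open Classical in
/-- Games decided at a finite level are determined. -/
theorem Decided.determined {B : Set T.Play} {N : ℕ} (h : Decided N B) (r : T.Pos)
    (hr : T.len r = 0) :
    (∃ s : T.Strat, ∀ x : T.Play, x.pos 0 = r → FollowsFrom 0 s 0 x → x ∈ B) ∨
      ∃ s : T.Strat, ∀ x : T.Play, x.pos 0 = r → FollowsFrom 1 s 0 x → x ∉ B := by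
  set U : Set T.Pos := {p | ∀ y : T.Play, y.pos N = p → y ∈ B} with hU
  by_cases hF : Force 0 {p | T.len p = N ∧ p ∈ U} r
  · left
    obtain ⟨s, hs⟩ := hF
    rw [hr] at hs
    refine ⟨s, fun x hx hf => ?_⟩
    obtain ⟨n, -, hn, hnU⟩ := hs x hx hf
    rw [x.len_pos] at hn
    exact hnU x (by rw [hn])
  · right
    let F : T.Pos → Prop := Force 0 {p | T.len p = N ∧ p ∈ U}
    refine ⟨T.legalize fun p => if h : ∃ z, T.Child p z ∧ ¬ F z then h.choose else p,
      fun x hx hf hxB => ?_⟩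
    have key : ∀ n, ¬ F (x.pos n) := by
      intro n
      induction n with
      | zero => rwa [hx]
      | succ n ih =>
        rcases Nat.mod_two_eq_zero_or_one n with hj | hj
        · exact fun hh => ih (Force.of_child (by rwa [x.len_pos]) (x.child n) hh)
        · have hex : ∃ z, T.Child (x.pos n) z ∧ ¬ F z := by
            by_contra! hcon
            exact ih (Force.of_forall_child hcon)
          rw [hf n (Nat.zero_le _) hj, legalize_mv] <;> rw [dif_pos hex]
          exacts [hex.choose_spec.2, hex.choose_spec.1]
    exact key N (force_of_mem ⟨x.len_pos N, fun y hy => (h y x hy).2 hxB⟩)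

/-- Borel determinacy. -/
theorem determined {B : Set T.Play} (hB : MeasurableSet B) (r : T.Pos) (hr : T.len r = 0) :
    (∃ s : T.Strat, ∀ x : T.Play, x.pos 0 = r → FollowsFrom 0 s 0 x → x ∈ B) ∨
      ∃ s : T.Strat, ∀ x : T.Play, x.pos 0 = r → FollowsFrom 1 s 0 x → x ∉ B := by
  obtain ⟨T', C, hC, N, hN⟩ := hB T (Hom.id T) 0
  obtain ⟨r', hr', huniq⟩ := hC.1 r hr.le
  have lift : ∀ j < 2, ∀ s (x : T.Play), x.pos 0 = r → FollowsFrom j (C.φ j s) 0 x →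
      ∃ y : T'.Play, y.pos 0 = r' ∧ FollowsFrom j s 0 y ∧ C.hom.play y = x := by
    intro j hj s x hx hf
    obtain ⟨y, hy, hyx⟩ := C.lift j hj s x hf
    exact ⟨y, huniq _ ((hyx 0).trans hx), hy, Play.ext hyx⟩
  rcases hN.determined r' (by rw [← C.len_π, hr', hr]) with ⟨s, hs⟩ | ⟨s, hs⟩
  · refine .inl ⟨C.φ 0 s, fun x hx hf => ?_⟩
    obtain ⟨y, hy, hys, rfl⟩ := lift 0 (by omega) s x hx hf
    exact hs y hy hys
  · refine .inr ⟨C.φ 1 s, fun x hx hf => ?_⟩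
    obtain ⟨y, hy, hys, rfl⟩ := lift 1 (by omega) s x hx hf
    exact hs y hy hys

end GameTree

section

open MeasureTheory Set Filter

/-- A Borel bipartite `n`-regular multigraph on `V`, each vertex having at most one edge of each
label: `nb k v` is the other end of the edge of label `k` at `v`, if there is one. -/
structure LabelledGraph (n : ℕ) (V : Type) [MeasurableSpace V] where
  dom : ℕ → Set V
  nb : ℕ → V → V
  side : V → Bool
  measurableSet_dom : ∀ k, MeasurableSet (dom k)
  measurable_nb : ∀ k, Measurable (nb k)
  measurable_side : Measurable side
  nb_mem : ∀ {k v}, v ∈ dom k → nb k v ∈ dom k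
  nb_nb : ∀ {k v}, v ∈ dom k → nb k (nb k v) = v
  side_nb : ∀ {k v}, v ∈ dom k → side (nb k v) = !side v
  encard_dom : ∀ v, {k | v ∈ dom k}.encard = n

namespace LabelledGraph

variable {n : ℕ} {V : Type} [MeasurableSpace V] (Γ : LabelledGraph n V)

/-- `O k` is the set of vertices at which the edge of label `k` points outwards. -/
def IsOrientation (O : ℕ → Set V) : Prop :=
  (∀ k, MeasurableSet (O k)) ∧ ∀ k, ∀ v ∈ Γ.dom k, (v ∈ O k ↔ Γ.nb k v ∉ O k)

/-- Some edge at `v` points outwards. -/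
def HasOut (O : ℕ → Set V) (v : V) : Prop := ∃ k, v ∈ Γ.dom k ∧ v ∈ O k

/-- The set `S` is a union of connected components. -/
def IsInvariant (S : Set V) : Prop := ∀ k, ∀ v ∈ Γ.dom k, (v ∈ S ↔ Γ.nb k v ∈ S)

variable {Γ}

theorem finite_labels (v : V) : {k | v ∈ Γ.dom k}.Finite :=
  finite_of_encard_eq_coe (Γ.encard_dom v)

/-- The orientation pointing outwards, at vertices of the side `false`, along the edges in `D`. -/
def orient (Γ : LabelledGraph n V) (D : Set (V × ℕ)) (k : ℕ) : Set V :=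
  {v | (Γ.side v = false ∧ (v, k) ∈ D) ∨ (Γ.side v = true ∧ (Γ.nb k v, k) ∉ D)}

theorem isOrientation_orient {D : Set (V × ℕ)} (hD : MeasurableSet D) :
    Γ.IsOrientation (Γ.orient D) := by
  refine ⟨fun k => ?_, fun k v hv => ?_⟩
  · have hs : ∀ b, MeasurableSet {v | Γ.side v = b} := fun b =>
      Γ.measurable_side (measurableSet_singleton b)
    have h1 : MeasurableSet {v | (v, k) ∈ D} := measurable_prodMk_right hD
    have h2 : MeasurableSet {v | (Γ.nb k v, k) ∈ D} := Γ.measurable_nb k h1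
    exact ((hs false).inter h1).union ((hs true).inter h2.compl)
  · simp only [orient, mem_ofPred_eq, Γ.side_nb hv, Γ.nb_nb hv]
    cases Γ.side v <;> simp

/-- The vertices from which there is a path of length `m` following the orientation `O`. -/
def outPath (Γ : LabelledGraph n V) (O : ℕ → Set V) : ℕ → Set V
  | 0 => univ
  | m + 1 => {v | ∃ k, v ∈ Γ.dom k ∧ v ∈ O k ∧ Γ.nb k v ∈ outPath Γ O m}

/-- The vertices at distance at most `d` from one with an infinite path following `O`. -/
def near (Γ : LabelledGraph n V) (O : ℕ → Set V) : ℕ → Set V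
  | 0 => ⋂ m, Γ.outPath O m
  | d + 1 => near Γ O d ∪ {v | ∃ k, v ∈ Γ.dom k ∧ Γ.nb k v ∈ near Γ O d}

variable {O : ℕ → Set V}

theorem measurableSet_outPath (hO : ∀ k, MeasurableSet (O k)) (m : ℕ) :
    MeasurableSet (Γ.outPath O m) := by
  induction m with
  | zero => exact MeasurableSet.univ
  | succ m ih =>
    have : Γ.outPath O (m + 1) = ⋃ k, Γ.dom k ∩ (O k ∩ Γ.nb k ⁻¹' Γ.outPath O m) := by
      ext v; simp [outPath]
    rw [this]
    exact .iUnion fun k => (Γ.measurableSet_dom k).inter ((hO k).inter (Γ.measurable_nb k ih))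

theorem measurableSet_near (hO : ∀ k, MeasurableSet (O k)) (d : ℕ) :
    MeasurableSet (Γ.near O d) := by
  induction d with
  | zero => exact .iInter fun m => measurableSet_outPath hO m
  | succ d ih =>
    have : Γ.near O (d + 1) = Γ.near O d ∪ ⋃ k, Γ.dom k ∩ Γ.nb k ⁻¹' Γ.near O d := by
      ext v; simp [near]
    rw [this]
    exact ih.union (.iUnion fun k => (Γ.measurableSet_dom k).inter (Γ.measurable_nb k ih))

theorem antitone_outPath : Antitone (Γ.outPath O) := by
  refine antitone_nat_of_succ_le fun m => ?_
  induction m with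
  | zero => exact subset_univ _
  | succ m ih =>
    rintro v ⟨k, h1, h2, h3⟩
    exact ⟨k, h1, h2, ih h3⟩

theorem monotone_near : Monotone (Γ.near O) :=
  monotone_nat_of_le_succ fun _ => subset_union_left

theorem exists_out_of_mem_near_zero {v : V} (hv : v ∈ Γ.near O 0) :
    ∃ k, v ∈ Γ.dom k ∧ v ∈ O k ∧ Γ.nb k v ∈ Γ.near O 0 := by
  by_contra! hcon
  have : ∀ᶠ m in atTop, ∀ k ∈ {k | v ∈ Γ.dom k}, v ∈ O k → Γ.nb k v ∉ Γ.outPath O m := by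
    refine (eventually_all_finite (finite_labels v)).2 fun k hk => ?_
    by_cases hkO : v ∈ O k
    · have h1 := hcon k hk hkO
      simp only [near, mem_iInter, not_forall] at h1
      obtain ⟨m, hm⟩ := h1
      exact eventually_atTop.2 ⟨m, fun m' hm' _ h => hm (antitone_outPath hm' h)⟩
    · exact .of_forall fun m h => absurd h hkO
  obtain ⟨m, hm⟩ := this.exists
  obtain ⟨k, h1, h2, h3⟩ := mem_iInter.1 hv (m + 1)
  exact hm k h1 h2 h3

theorem subset_near_zero {Y : Set V} (hY : ∀ v ∈ Y, ∃ k, v ∈ Γ.dom k ∧ v ∈ O k ∧ Γ.nb k v ∈ Y) :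
    Y ⊆ Γ.near O 0 := by
  have : ∀ m, Y ⊆ Γ.outPath O m := by
    intro m
    induction m with
    | zero => exact subset_univ _
    | succ m ih =>
      intro v hv
      obtain ⟨k, h1, h2, h3⟩ := hY v hv
      exact ⟨k, h1, h2, ih h3⟩
  exact subset_iInter this

/-- The orientation pointing towards the vertices with an infinite path following `O`, and
extending `O` between vertices at equal distance from these. -/
def towards (Γ : LabelledGraph n V) (O : ℕ → Set V) (k : ℕ) : Set V :=
  {v | (∃ d, Γ.nb k v ∈ Γ.near O d ∧ v ∉ Γ.near O d) ∨
    (∀ d, Γ.nb k v ∈ Γ.near O d ↔ v ∈ Γ.near O d) ∧ v ∈ O k}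

theorem isOrientation_towards (hO : Γ.IsOrientation O) : Γ.IsOrientation (Γ.towards O) := by
  have hnear := measurableSet_near (Γ := Γ) hO.1
  refine ⟨fun k => ?_, fun k v hv => ?_⟩
  · have hnb := fun d => Γ.measurable_nb k (hnear d)
    have hiff : ∀ d, MeasurableSet {v | Γ.nb k v ∈ Γ.near O d ↔ v ∈ Γ.near O d} := fun d =>
      (hnb d).iff (hnear d)
    exact (MeasurableSet.iUnion fun d => (hnb d).inter (hnear d).compl).union
      ((MeasurableSet.iInter hiff).inter (hO.1 k)) |>.congr (by ext v; simp [towards])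
  · simp only [towards, mem_ofPred_eq, Γ.nb_nb hv]
    rw [hO.2 k v hv]
    by_cases h1 : ∃ d, Γ.nb k v ∈ Γ.near O d ∧ v ∉ Γ.near O d
    · obtain ⟨d, hd, hd'⟩ := h1
      refine iff_of_true (.inl ⟨d, hd, hd'⟩) (not_or.2 ⟨?_, fun h => hd' ((h.1 d).2 hd)⟩)
      rintro ⟨e, he, he'⟩
      rcases le_total d e with h | h
      exacts [he' (monotone_near h hd), hd' (monotone_near h he)]
    by_cases h2 : ∃ d, v ∈ Γ.near O d ∧ Γ.nb k v ∉ Γ.near O d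
    · obtain ⟨d, hd, hd'⟩ := id h2
      exact iff_of_false (not_or.2 ⟨h1, fun h => hd' ((h.1 d).2 hd)⟩) (not_not.2 (.inl h2))
    · have h : ∀ d, Γ.nb k v ∈ Γ.near O d ↔ v ∈ Γ.near O d := by
        intro d
        push Not at h1 h2
        exact ⟨h1 d, h2 d⟩
      simp [h]

theorem hasOut_towards {v : V} (hv : v ∈ ⋃ d, Γ.near O d) : Γ.HasOut (Γ.towards O) v := by
  obtain ⟨d, hd⟩ := mem_iUnion.1 hv
  induction d with
  | zero =>
    obtain ⟨k, h1, h2, h3⟩ := exists_out_of_mem_near_zero hd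
    exact ⟨k, h1, .inr ⟨fun d => iff_of_true (monotone_near (Nat.zero_le d) h3)
      (monotone_near (Nat.zero_le d) hd), h2⟩⟩
  | succ d ih =>
    by_cases h : v ∈ Γ.near O d
    · exact ih h
    · obtain ⟨k, h1, h2⟩ := hd.resolve_left h
      exact ⟨k, h1, .inl ⟨d, h2, h⟩⟩

theorem isInvariant_iUnion_near : Γ.IsInvariant (⋃ d, Γ.near O d) := by
  have key : ∀ k, ∀ v ∈ Γ.dom k, Γ.nb k v ∈ ⋃ d, Γ.near O d → v ∈ ⋃ d, Γ.near O d := by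
    intro k v hv h
    obtain ⟨d, hd⟩ := mem_iUnion.1 h
    exact mem_iUnion.2 ⟨d + 1, .inr ⟨k, hv, hd⟩⟩
  exact fun k v hv => ⟨fun h => key k _ (Γ.nb_mem hv) (by rwa [Γ.nb_nb hv]), key k v hv⟩

/-- Countably many orientations with out-edges on invariant sets can be merged. -/
theorem exists_orientation_iUnion {S : ℕ → Set V} {O : ℕ → ℕ → Set V}
    (hSm : ∀ i, MeasurableSet (S i)) (hS : ∀ i, Γ.IsInvariant (S i))
    (hOm : ∀ i k, MeasurableSet (O i k))
    (hO : ∀ i k, ∀ v ∈ S i, v ∈ Γ.dom k → (v ∈ O i k ↔ Γ.nb k v ∉ O i k))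
    (hout : ∀ i, ∀ v ∈ S i, Γ.HasOut (O i) v)
    (hcover : ∀ v, ∃ i, v ∈ S i) :
    ∃ O', Γ.IsOrientation O' ∧ ∀ v, Γ.HasOut O' v := by
  classical
  have hiff : ∀ k v, (∃ i, v ∈ disjointed S i ∧ v ∈ O i k) ↔ v ∈ O (Nat.find (hcover v)) k := by
    intro k v
    have hmem : ∀ i, v ∈ disjointed S i ↔ i = Nat.find (hcover v) := by
      intro i
      rw [disjointed_eq_inter_compl, eq_comm, Nat.find_eq_iff]
      simp
    simp [hmem]
  refine ⟨fun k => {v | ∃ i, v ∈ disjointed S i ∧ v ∈ O i k}, ⟨fun k => ?_, fun k v hv => ?_⟩,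
    fun v => ?_⟩
  · exact (MeasurableSet.iUnion fun i => (MeasurableSet.disjointed hSm i).inter (hOm i k)).congr
      (by ext v; simp)
  · have e : Nat.find (hcover (Γ.nb k v)) = Nat.find (hcover v) := by
      congr 1; funext i; exact propext ((hS i k v hv).symm)
    simp only [mem_ofPred_eq, hiff, e]
    exact hO _ k v (Nat.find_spec (hcover v)) hv
  · obtain ⟨k, hk, hkO⟩ := hout _ v (Nat.find_spec (hcover v))
    exact ⟨k, hk, (hiff k v).2 hkO⟩

end LabelledGraph

/-- In a standard Borel space, disjoint finite sets are separated by a countable family of Borel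
sets. -/
theorem exists_seq_measurableSet_separating (W : Type) [MeasurableSpace W]
    [MeasurableSpace.CountablySeparated W] :
    ∃ D : ℕ → Set W, (∀ i, MeasurableSet (D i)) ∧ ∀ P Q : Set W, P.Finite → Q.Finite →
      Disjoint P Q → ∃ i, P ⊆ D i ∧ Disjoint Q (D i) := by
  obtain ⟨f, hf, hinj⟩ := MeasurableSpace.measurable_injection_nat_bool_of_countablySeparated W
  obtain ⟨e, he⟩ := exists_surjective_nat (Σ m : ℕ, Set (Fin m → Bool))
  have hg : ∀ m, Measurable fun (w : W) (i : Fin m) => f w i := fun m =>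
    measurable_pi_lambda _ fun i => (measurable_pi_apply _).comp hf
  refine ⟨fun i => (fun w (j : Fin (e i).1) => f w j) ⁻¹' (e i).2, fun i =>
    hg _ (MeasurableSet.of_discrete), fun P Q hP hQ hPQ => ?_⟩
  have hev : ∀ᶠ m in atTop, ∀ p ∈ P, ∀ q ∈ Q,
      (fun i : Fin m => f p i) ≠ fun i : Fin m => f q i := by
    refine (eventually_all_finite hP).2 fun p hp => (eventually_all_finite hQ).2 fun q hq => ?_
    have hne : f p ≠ f q := fun h => disjoint_left.1 hPQ hp (hinj h ▸ hq)
    obtain ⟨i, hi⟩ := Function.ne_iff.1 hne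
    exact eventually_atTop.2 ⟨i + 1, fun m hm h => hi (congrFun h ⟨i, hm⟩)⟩
  obtain ⟨m, hm⟩ := hev.exists
  obtain ⟨i, hi⟩ := he ⟨m, (fun w (j : Fin m) => f w j) '' P⟩
  refine ⟨i, ?_, ?_⟩
  · beta_reduce
    rw [hi]
    exact fun p hp => ⟨p, hp, rfl⟩
  · beta_reduce
    rw [hi]
    refine disjoint_left.2 fun q hq => ?_
    rintro ⟨p, hp, h⟩
    exact hm p hp q hq h

namespace LabelledGraph

variable {n : ℕ} {V : Type} [MeasurableSpace V] {Γ : LabelledGraph n V}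

/-- A set of darts which can be followed forever and contains no dart together with its reverse
gives infinite outward paths in some of the orientations separating finite sets of darts. -/
theorem exists_mem_iUnion_near {D : ℕ → Set (V × ℕ)}
    (hD : ∀ P Q : Set (V × ℕ), P.Finite → Q.Finite → Disjoint P Q →
      ∃ i, P ⊆ D i ∧ Disjoint Q (D i))
    {E : Set (V × ℕ)} (hE : E.Finite) (hdom : ∀ v k, (v, k) ∈ E → v ∈ Γ.dom k)
    (hnext : ∀ v k, (v, k) ∈ E → ∃ k', (Γ.nb k v, k') ∈ E)
    (hrev : ∀ v k, (v, k) ∈ E → (Γ.nb k v, k) ∉ E) {v : V} {k : ℕ} (hv : (v, k) ∈ E) :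
    ∃ i, v ∈ ⋃ d, Γ.near (Γ.orient (D i)) d := by
  obtain ⟨i, hP, hQ⟩ := hD {p | p ∈ E ∧ Γ.side p.1 = false}
    ((fun p : V × ℕ => (Γ.nb p.2 p.1, p.2)) '' {p | p ∈ E ∧ Γ.side p.1 = true})
    (hE.subset fun p hp => hp.1) ((hE.subset fun p hp => hp.1).image _) (by
      refine disjoint_left.2 ?_
      rintro _ ⟨h, -⟩ ⟨⟨u, l⟩, ⟨hu, -⟩, rfl⟩
      exact hrev u l hu h)
  refine ⟨i, mem_iUnion.2 ⟨0, subset_near_zero (Y := {v | ∃ k, (v, k) ∈ E}) ?_ ⟨k, hv⟩⟩⟩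
  rintro u ⟨l, hu⟩
  refine ⟨l, hdom u l hu, ?_, hnext u l hu⟩
  cases hs : Γ.side u with
  | false => exact .inl ⟨hs, hP ⟨hu, hs⟩⟩
  | true => exact .inr ⟨hs, disjoint_left.1 hQ ⟨(u, l), ⟨hu, hs⟩, rfl⟩⟩

/-- The simple graph induced on a set of vertices. -/
def simpleGraph (Γ : LabelledGraph n V) (L : Set V) : SimpleGraph L where
  Adj x y := ∃ k, (x : V) ∈ Γ.dom k ∧ Γ.nb k x = y
  symm := ⟨by
    rintro x y ⟨k, hk, h⟩
    exact ⟨k, h ▸ Γ.nb_mem hk, by rw [← h, Γ.nb_nb hk]⟩⟩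
  loopless := ⟨by
    rintro x ⟨k, hk, h⟩
    have := Γ.side_nb hk
    rw [h] at this
    simp at this⟩

theorem isAcyclic_simpleGraph {D : ℕ → Set (V × ℕ)}
    (hD : ∀ P Q : Set (V × ℕ), P.Finite → Q.Finite → Disjoint P Q →
      ∃ i, P ⊆ D i ∧ Disjoint Q (D i)) :
    (Γ.simpleGraph (⋃ i, ⋃ d, Γ.near (Γ.orient (D i)) d)ᶜ).IsAcyclic := by
  obtain ⟨G, hG⟩ : ∃ G, G = Γ.simpleGraph (⋃ i, ⋃ d, Γ.near (Γ.orient (D i)) d)ᶜ := ⟨_, rfl⟩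
  rw [← hG]
  intro x w hw
  choose κ hκ hκ' using fun d : G.Dart =>
    (hG ▸ d.adj : ∃ k, (d.fst : V) ∈ Γ.dom k ∧ Γ.nb k d.fst = d.snd)
  have hx : ∃ d ∈ w.darts, d.fst = x := by
    cases w with
    | nil => exact (hw.ne_nil rfl).elim
    | cons h p => exact ⟨_, by rw [SimpleGraph.Walk.darts_cons]; exact List.mem_cons_self, rfl⟩
  obtain ⟨d₀, hd₀, -⟩ := id hx
  obtain ⟨i, hi⟩ := exists_mem_iUnion_near hD (Γ := Γ)
    (E := (fun d : G.Dart => ((d.fst : V), κ d)) '' {d | d ∈ w.darts})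
    ((List.finite_toSet _).image _) (by
      rintro _ _ ⟨d, -, h⟩
      obtain ⟨rfl, rfl⟩ := Prod.mk.inj h
      exact hκ d) (by
      rintro _ _ ⟨d, hd, h⟩
      obtain ⟨rfl, rfl⟩ := Prod.mk.inj h
      obtain ⟨d', hd', h⟩ : ∃ d' ∈ w.darts, d'.fst = d.snd := by
        have h1 : d.snd ∈ w.support := by
          rw [← w.cons_map_snd_darts]
          exact List.mem_cons_of_mem _ (List.mem_map_of_mem hd)
        rw [← w.map_fst_darts_append, List.mem_append, List.mem_singleton] at h1
        rcases h1 with h1 | h1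
        · simpa using List.mem_map.1 h1
        · rwa [h1]
      exact ⟨κ d', d', hd', by simp only [hκ', h]⟩) (by
      rintro _ _ ⟨d, hd, h⟩ ⟨d', hd', h'⟩
      obtain ⟨rfl, rfl⟩ := Prod.mk.inj h
      obtain ⟨h1, h2⟩ := Prod.mk.inj h'
      rw [hκ'] at h1
      have h3 : (d'.snd : V) = d.fst := by
        rw [← hκ', h1, h2, ← hκ', Γ.nb_nb (hκ d)]
      have h4 : d'.edge = d.edge := by
        rw [SimpleGraph.dart_edge_eq_iff]
        exact .inr (SimpleGraph.Dart.ext _ _ (Prod.ext (Subtype.ext h1) (Subtype.ext h3)))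
      have h5 : d' = d := List.inj_on_of_nodup_map hw.isTrail.edges_nodup hd' hd h4
      exact d.adj.ne (by rw [← Subtype.ext h1, h5])) (mem_image_of_mem _ hd₀)
  exact d₀.fst.2 (mem_iUnion.2 ⟨i, hi⟩)

theorem injOn_nb {D : ℕ → Set (V × ℕ)}
    (hD : ∀ P Q : Set (V × ℕ), P.Finite → Q.Finite → Disjoint P Q →
      ∃ i, P ⊆ D i ∧ Disjoint Q (D i))
    {v : V} (hv : v ∈ (⋃ i, ⋃ d, Γ.near (Γ.orient (D i)) d)ᶜ) :
    InjOn (fun k => Γ.nb k v) {k | v ∈ Γ.dom k} := by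
  intro k hk k' hk' h
  by_contra hne
  obtain ⟨u, hu⟩ : ∃ u, u = Γ.nb k v := ⟨_, rfl⟩
  have hu' : u = Γ.nb k' v := hu.trans h
  have huv : u ≠ v := by
    rintro rfl
    have := Γ.side_nb hk
    rw [← hu] at this
    simp at this
  obtain ⟨i, hi⟩ := exists_mem_iUnion_near hD (Γ := Γ) (E := {(v, k), (u, k')}) (toFinite _)
    (by
      rintro _ _ (h | h) <;> obtain ⟨rfl, rfl⟩ := Prod.mk.inj h
      exacts [hk, hu' ▸ Γ.nb_mem hk'])
    (by
      rintro _ _ (h | h) <;> obtain ⟨rfl, rfl⟩ := Prod.mk.inj h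
      exacts [⟨k', .inr (by rw [← hu]; rfl)⟩, ⟨k, .inl (by rw [hu', Γ.nb_nb hk'])⟩])
    (by
      rintro _ _ (h | h) <;> obtain ⟨rfl, rfl⟩ := Prod.mk.inj h
      · rw [← hu]
        rintro (h | h)
        exacts [huv (Prod.mk.inj h).1, hne (Prod.mk.inj h).2]
      · rw [hu', Γ.nb_nb hk']
        rintro (h | h)
        exacts [hne (Prod.mk.inj h).2.symm, huv (hu'.trans (Prod.mk.inj h).1.symm)])
    (.inl rfl)
  exact hv (mem_iUnion.2 ⟨i, hi⟩)

/-- A labelled graph all of whose Borel orientations have a vertex without outward edges gives a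
graph without small edge colorings. -/
theorem exists_simpleGraph [StandardBorelSpace V] (hn : 1 ≤ n)
    (hΓ : ¬∃ O, Γ.IsOrientation O ∧ ∀ v, Γ.HasOut O v) :
    ∃ (X : Type) (mX : MeasurableSpace X) (G : SimpleGraph X),
      @StandardBorelSpace X mX ∧
      @MeasurableSet (X × X) (@Prod.instMeasurableSpace X X mX mX)
        {p : X × X | G.Adj p.1 p.2} ∧
      (∀ x, (G.neighborSet x).encard = n) ∧
      G.IsAcyclic ∧
      (∃ A : Set X, @MeasurableSet X mX A ∧ ∀ x y, G.Adj x y → (x ∈ A ↔ y ∉ A)) ∧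
      ¬∃ c : X × X → Fin (2 * n - 2),
        @Measurable (X × X) (Fin (2 * n - 2)) (@Prod.instMeasurableSpace X X mX mX) _ c ∧
        (∀ x y, G.Adj x y → c (x, y) = c (y, x)) ∧
        (∀ x y z, G.Adj x y → G.Adj x z → y ≠ z → c (x, y) ≠ c (x, z)) := by
  classical
  obtain ⟨D, hDm, hD⟩ := exists_seq_measurableSet_separating (V × ℕ)
  have hO := fun i => isOrientation_towards (isOrientation_orient (Γ := Γ) (hDm i))
  have hSm : ∀ i, MeasurableSet (⋃ d, Γ.near (Γ.orient (D i)) d) := fun i =>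
    .iUnion (measurableSet_near (isOrientation_orient (hDm i)).1)
  obtain ⟨L, hL⟩ : ∃ L, L = (⋃ i, ⋃ d, Γ.near (Γ.orient (D i)) d)ᶜ := ⟨_, rfl⟩
  have hLm : MeasurableSet L := hL ▸ (MeasurableSet.iUnion hSm).compl
  have hLinv : Γ.IsInvariant L := by
    intro k v hv
    simp only [hL, mem_compl_iff, mem_iUnion (s := fun i => ⋃ d, Γ.near (Γ.orient (D i)) d)]
    exact not_congr (exists_congr fun i => isInvariant_iUnion_near k v hv)
  have hinj : ∀ x : L, InjOn (fun k => Γ.nb k x) {k | (x : V) ∈ Γ.dom k} := fun x =>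
    injOn_nb hD (hL ▸ x.2)
  let f : ℕ → L → L := fun k x =>
    ⟨if (x : V) ∈ Γ.dom k then Γ.nb k x else x, by
      split_ifs with h
      exacts [(hLinv k x h).1 x.2, x.2]⟩
  have hf : ∀ k, Measurable (f k) := fun k =>
    (Measurable.ite (measurable_subtype_coe (Γ.measurableSet_dom k))
      ((Γ.measurable_nb k).comp measurable_subtype_coe) measurable_subtype_coe).subtype_mk
  have hfv : ∀ {k} {x : L}, (x : V) ∈ Γ.dom k → (f k x : V) = Γ.nb k x := fun h => if_pos h
  have hadj : ∀ {k} {x : L}, (x : V) ∈ Γ.dom k → (Γ.simpleGraph L).Adj x (f k x) := fun {k x} h =>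
    ⟨k, h, (hfv h).symm⟩
  have hside : ∀ b, MeasurableSet {x : L | Γ.side x = b} := fun b =>
    Γ.measurable_side.comp measurable_subtype_coe (measurableSet_singleton b)
  have : StandardBorelSpace L := hLm.standardBorel
  refine ⟨L, inferInstance, Γ.simpleGraph L, inferInstance, ?_, fun x => ?_, ?_,
    ⟨{x | Γ.side x = true}, hside true, ?_⟩, ?_⟩
  · have : {p : L × L | (Γ.simpleGraph L).Adj p.1 p.2} =
        ⋃ k, {p : L × L | (p.1 : V) ∈ Γ.dom k} ∩ {p | f k p.1 = p.2} := by
      ext p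
      simp only [mem_iUnion, mem_inter_iff, mem_ofPred_eq]
      refine exists_congr fun k => and_congr_right fun h => ?_
      rw [Subtype.ext_iff, hfv h]
    rw [this]
    exact .iUnion fun k =>
      ((measurable_subtype_coe.comp measurable_fst) (Γ.measurableSet_dom k)).inter
        (measurableSet_eq_fun ((hf k).comp measurable_fst) measurable_snd)
  · rw [← Subtype.val_injective.encard_image, ← Γ.encard_dom x, ← (hinj x).encard_image]
    congr 1
    ext u
    constructor
    · rintro ⟨y, ⟨k, hk, h⟩, rfl⟩
      exact ⟨k, hk, h⟩
    · rintro ⟨k, hk, rfl⟩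
      exact ⟨f k x, hadj hk, hfv hk⟩
  · rw [hL]
    exact isAcyclic_simpleGraph hD
  · rintro x y ⟨k, hk, h⟩
    have := Γ.side_nb hk
    rw [h] at this
    simp [this]
  rintro ⟨c, hc, hsymm, hcol⟩
  have hcinj : ∀ x : L, InjOn (fun k => (c (x, f k x) : ℕ)) {k | (x : V) ∈ Γ.dom k} := by
    intro x k hk k' hk' h
    by_contra hne
    refine hcol x _ _ (hadj hk) (hadj hk') (fun h' => hne (hinj x hk hk' ?_)) (Fin.ext h)
    simpa only [hfv hk, hfv hk'] using congrArg Subtype.val h'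
  have hcard : ∀ x : L, ∀ t : Finset ℕ, t.card = n - 1 →
      ∃ k, (x : V) ∈ Γ.dom k ∧ (c (x, f k x) : ℕ) ∉ t := by
    intro x t ht
    by_contra! hcon
    have := encard_le_encard_of_injOn (t := (t : Set ℕ)) hcon (hcinj x)
    change {k | (x : V) ∈ Γ.dom k}.encard ≤ _ at this
    rw [Γ.encard_dom, encard_coe_eq_coe_finsetCard, ht, Nat.cast_le] at this
    omega
  let B : ℕ → Set L := fun k => {x | (Γ.side x = false ∧ n - 1 ≤ (c (x, f k x) : ℕ)) ∨
    (Γ.side x = true ∧ (c (x, f k x) : ℕ) < n - 1)}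
  have hcm : ∀ k, Measurable fun x : L => (c (x, f k x) : ℕ) := fun k =>
    (Measurable.of_discrete (f := fun a : Fin (2 * n - 2) => (a : ℕ))).comp
      (hc.comp (measurable_id.prodMk (hf k)))
  have hBm : ∀ k, MeasurableSet (B k) := fun k =>
    ((hside false).inter (hcm k measurableSet_Ici)).union
      ((hside true).inter (hcm k measurableSet_Iio))
  have hmem : ∀ (x : L) k, (x : V) ∈ Subtype.val '' B k ↔ x ∈ B k := fun x k =>
    Subtype.val_injective.mem_set_image
  refine hΓ (exists_orientation_iUnion
    (S := fun i => Nat.casesOn i L fun i => ⋃ d, Γ.near (Γ.orient (D i)) d)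
    (O := fun i => Nat.casesOn i (fun k => Subtype.val '' B k)
      fun i => Γ.towards (Γ.orient (D i))) ?_ ?_ ?_ ?_ ?_ ?_)
  · rintro (_ | i)
    exacts [hLm, hSm i]
  · rintro (_ | i)
    exacts [hLinv, isInvariant_iUnion_near]
  · rintro (_ | i) k
    exacts [hLm.subtype_image (hBm k), (hO i).1 k]
  · rintro (_ | i) k v hv hvk
    · lift v to L using hv
      have h1 := hfv hvk
      have h2 : f k (f k v) = v := Subtype.ext (by
        rw [hfv (h1 ▸ Γ.nb_mem hvk), h1, Γ.nb_nb hvk])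
      have h3 := Γ.side_nb hvk
      have h4 : c (f k v, v) = c (v, f k v) := (hsymm _ _ (hadj hvk)).symm
      change _ ∈ Subtype.val '' B k ↔ _ ∉ Subtype.val '' B k
      rw [← h1] at h3 ⊢
      rw [hmem, hmem]
      simp only [B, mem_ofPred_eq, h2, h3, h4]
      cases Γ.side v <;> simp
      omega
    · exact (hO i).2 k v hvk
  · rintro (_ | i) v hv
    · lift v to L using hv
      cases hs : Γ.side v with
      | false =>
        obtain ⟨k, hk, h⟩ := hcard v (Finset.range (n - 1)) (Finset.card_range _)
        exact ⟨k, hk, (hmem v k).2 (.inl ⟨hs, by simpa using h⟩)⟩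
      | true =>
        obtain ⟨k, hk, h⟩ := hcard v (Finset.Ico (n - 1) (2 * n - 2)) (by simp; omega)
        refine ⟨k, hk, (hmem v k).2 (.inr ⟨hs, ?_⟩)⟩
        have := (c (v, f k v)).2
        rw [Finset.mem_Ico] at h
        omega
    · exact hasOut_towards hv
  · intro v
    by_cases hv : v ∈ L
    · exact ⟨0, hv⟩
    · rw [hL, mem_compl_iff, not_not] at hv
      obtain ⟨i, hi⟩ := mem_iUnion.1 hv
      exact ⟨i + 1, hi⟩

end LabelledGraph

/-- Left multiplication by the generator `k` of a free product of groups of order two, whose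
elements are the words without equal consecutive letters. -/
def consMul (k : ℕ) : List ℕ → List ℕ
  | [] => [k]
  | a :: w => if a = k then w else k :: a :: w

theorem isChain_consMul {k : ℕ} {w : List ℕ} (hw : w.IsChain (· ≠ ·)) :
    (consMul k w).IsChain (· ≠ ·) := by
  cases w with
  | nil => exact .singleton k
  | cons a w =>
    rw [consMul]
    split_ifs with h
    exacts [hw.tail, List.isChain_cons_cons.2 ⟨Ne.symm h, hw⟩]

theorem consMul_consMul {k : ℕ} {w : List ℕ} (hw : w.IsChain (· ≠ ·)) :
    consMul k (consMul k w) = w := by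
  match w with
  | [] => simp [consMul]
  | [a] => by_cases h : a = k <;> simp [consMul, h]
  | a :: b :: w =>
    have hab := (List.isChain_cons_cons.1 hw).1
    by_cases h : a = k
    · subst h; simp [consMul, hab.symm]
    · simp [consMul, h]

/-- A set of words that is, as a subgraph of the Cayley graph of the free product, an `n`-regular
tree rooted at the empty word. -/
structure IsTree (n : ℕ) (A : List ℕ → Prop) : Prop where
  nil : A []
  isChain : ∀ w, A w → w.IsChain (· ≠ ·)
  encard : ∀ w, A w → {l | A (w ++ [l]) ∨ w.getLast? = some l}.encard = n

/-- The tree `A` rerooted at the other end of its edge of label `k`. -/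
def reroot (k : ℕ) (A : List ℕ → Prop) (w : List ℕ) : Prop :=
  w.IsChain (· ≠ ·) ∧ A (consMul k w)

theorem reroot_reroot {n k : ℕ} {A : List ℕ → Prop} (hA : IsTree n A) :
    reroot k (reroot k A) = A := by
  funext w
  refine propext ⟨fun ⟨h1, h2, h3⟩ => consMul_consMul h1 ▸ h3, fun h => ?_⟩
  have hw := hA.isChain w h
  exact ⟨hw, isChain_consMul hw, by rwa [consMul_consMul hw]⟩

theorem IsTree.reroot {n k : ℕ} {A : List ℕ → Prop} (hA : IsTree n A) (hk : A [k]) :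
    IsTree n (reroot k A) where
  nil := ⟨.nil, hk⟩
  isChain _ h := h.1
  encard w h := by
    obtain ⟨hw, h⟩ := h
    rw [← hA.encard _ h]
    congr 1
    ext l
    have hch : ∀ u, A (u ++ [l]) → ∀ a ∈ u.getLast?, a ≠ l := fun u hu a ha =>
      (List.isChain_append.1 (hA.isChain _ hu)).2.2 a ha l rfl
    have hconcat : (w ++ [l]).IsChain (· ≠ ·) ↔ ∀ a ∈ w.getLast?, a ≠ l := by
      simp [List.isChain_append, hw]
    simp only [_root_.reroot, mem_ofPred_eq, hconcat]
    match w with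
    | [] =>
      by_cases hl : l = k
      · simp [consMul, hl, hA.nil]
      · simp [consMul, hl, Ne.symm hl]
    | [a] =>
      by_cases ha : a = k
      · subst ha
        by_cases hl : l = a
        · simp [consMul, hl, hk]
        · simp [consMul, Ne.symm hl]
      · have := hch [k, a]
        simp [consMul, ha] at this ⊢
        tauto
    | a :: b :: w =>
      by_cases ha : a = k
      · have := hch (b :: w)
        simp [consMul, ha] at this ⊢
        tauto
      · have := hch (k :: a :: b :: w)
        simp [consMul, ha] at this ⊢
        tauto

theorem measurableSet_isTree (n : ℕ) : MeasurableSet {A | IsTree n A} := by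
  have : {A | IsTree n A} = {A : List ℕ → Prop | A [] ∧ (∀ w, A w → w.IsChain (· ≠ ·)) ∧
      ∀ w, A w → ∃ s : Finset ℕ, s.card = n ∧
        ∀ l, (A (w ++ [l]) ∨ w.getLast? = some l) ↔ l ∈ s} := by
    ext A
    refine ⟨fun h => ⟨h.nil, h.isChain, fun w hw => ?_⟩, fun h => ⟨h.1, h.2.1, fun w hw => ?_⟩⟩
    · have h' := h.encard w hw
      have hfin := finite_of_encard_eq_coe h'
      refine ⟨hfin.toFinset, ?_, fun l => by simp⟩
      rwa [hfin.encard_eq_coe_toFinset_card, Nat.cast_inj] at h'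
    · obtain ⟨s, hs, h'⟩ := h.2.2 w hw
      rw [← hs, ← encard_coe_eq_coe_finsetCard]
      congr 1
      ext l
      exact h' l
  rw [this]
  have hm : ∀ w, Measurable fun A : List ℕ → Prop => A w := measurable_pi_apply
  exact measurableSet_setOfPred.2 ((hm _).and ((Measurable.forall fun w =>
    (hm w).imp measurable_const).and (.forall fun w => (hm w).imp (.exists fun s =>
      measurable_const.and (.forall fun l => ((hm _).or measurable_const).iff measurable_const)))))

theorem measurable_of_forall_measurable_apply {Z : Type} [MeasurableSpace Z] {n : ℕ}
    {f : Z → {A : List ℕ → Prop // IsTree n A}} (hf : ∀ w, Measurable fun z => (f z).1 w) :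
    Measurable f :=
  Measurable.subtype_mk (measurable_pi_iff.2 hf) (h := fun z => (f z).2)

open Classical in
/-- The graph of `n`-regular rooted trees in the free product, two trees being adjacent if one is
obtained from the other by moving the root along an edge. -/
noncomputable def treeGraph (n : ℕ) :
    LabelledGraph n ({A : List ℕ → Prop // IsTree n A} × Bool) where
  dom k := {v | v.1.1 [k]}
  nb k v := (if h : v.1.1 [k] then ⟨reroot k v.1.1, v.1.2.reroot h⟩ else v.1, !v.2)
  side v := v.2
  measurableSet_dom k := (measurable_pi_apply [k]).comp
    (measurable_subtype_coe.comp measurable_fst) |>.setOf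
  measurable_nb k := by
    have hm : ∀ w, Measurable fun v : {A : List ℕ → Prop // IsTree n A} × Bool => v.1.1 w :=
      fun w => (measurable_pi_apply w).comp (measurable_subtype_coe.comp measurable_fst)
    refine .prodMk ?_ ((Measurable.of_discrete (f := Bool.not)).comp measurable_snd)
    refine measurable_of_forall_measurable_apply fun w => ?_
    have : (fun v : {A : List ℕ → Prop // IsTree n A} × Bool =>
        (if h : v.1.1 [k] then ⟨reroot k v.1.1, v.1.2.reroot h⟩ else v.1 :
          {A : List ℕ → Prop // IsTree n A}).1 w) = fun v =>
        (v.1.1 [k] ∧ w.IsChain (· ≠ ·) ∧ v.1.1 (consMul k w)) ∨ ¬ v.1.1 [k] ∧ v.1.1 w := by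
      funext v
      by_cases h : v.1.1 [k] <;> simp [h, reroot]
    rw [this]
    exact ((hm _).and (measurable_const.and (hm _))).or ((hm _).not.and (hm _))
  measurable_side := measurable_snd
  nb_mem {k v} h := by
    change v.1.1 [k] at h
    simpa [h, reroot, consMul] using v.1.2.nil
  nb_nb {k v} h := by
    change v.1.1 [k] at h
    have h' : reroot k v.1.1 [k] := ⟨.singleton k, by simpa [consMul] using v.1.2.nil⟩
    ext1
    · simp [h, h', reroot_reroot v.1.2]
    · simp
  side_nb _ := rfl
  encard_dom v := by simpa using v.1.2.encard [] v.1.2.nil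

instance (n : ℕ) : StandardBorelSpace {A : List ℕ → Prop // IsTree n A} :=
  (measurableSet_isTree n).standardBorel

/-- The function `c` prescribes sets of children of the vertices `k :: u` for a branch, starting
with the edge of label `k`, of an `n`-regular tree. -/
def IsBranching (n k : ℕ) (c : List ℕ → Finset ℕ) : Prop :=
  ∀ u, (c u).card = n - 1 ∧ u.getLastD k ∉ c u

/-- The words in the tree with sets of children prescribed by `c`. -/
def InBranch : (List ℕ → Finset ℕ) → List ℕ → Prop
  | _, [] => True
  | c, l :: w => l ∈ c [] ∧ InBranch (fun u => c (l :: u)) w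

variable {n k : ℕ}

theorem IsBranching.tail {c : List ℕ → Finset ℕ} (hc : IsBranching n k c) (l : ℕ) :
    IsBranching n l fun u => c (l :: u) := fun u => by
  simpa only [List.getLastD_cons] using hc (l :: u)

theorem inBranch_concat {c : List ℕ → Finset ℕ} {w : List ℕ} {l : ℕ} :
    InBranch c (w ++ [l]) ↔ InBranch c w ∧ l ∈ c w := by
  induction w generalizing c with
  | nil => simp [InBranch]
  | cons a w ih => simp [InBranch, ih, and_assoc]

theorem InBranch.isChain_cons {c : List ℕ → Finset ℕ} {w : List ℕ} (hc : IsBranching n k c)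
    (h : InBranch c w) : (k :: w).IsChain (· ≠ ·) := by
  induction w generalizing c k with
  | nil => exact .singleton k
  | cons l w ih =>
    exact List.isChain_cons_cons.2 ⟨fun e => (hc []).2 (e ▸ h.1), ih (hc.tail l) h.2⟩

theorem not_inBranch_cons {c : List ℕ → Finset ℕ} (hc : IsBranching n k c) {w : List ℕ} :
    ¬InBranch c (k :: w) := fun h => (hc []).2 h.1

theorem inBranch_congr {c c' : List ℕ → Finset ℕ} {w : List ℕ}
    (h : ∀ u, u.length < w.length → c u = c' u) : InBranch c w ↔ InBranch c' w := by
  induction w generalizing c c' with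
  | nil => rfl
  | cons l w ih =>
    rw [InBranch, InBranch, h [] (by simp), ih fun u hu => h _ (by simpa using hu)]

/-- The tree made of two branches joined by an edge of label `k`. -/
def joinBranches (k : ℕ) (c c' : List ℕ → Finset ℕ) (w : List ℕ) : Prop :=
  InBranch c w ∨ ∃ w', w = k :: w' ∧ InBranch c' w'

theorem isTree_joinBranches (hn : 1 ≤ n) {c c' : List ℕ → Finset ℕ} (hc : IsBranching n k c)
    (hc' : IsBranching n k c') : IsTree n (joinBranches k c c') where
  nil := .inl trivial
  isChain := by
    rintro w (h | ⟨w, rfl, h⟩)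
    exacts [(h.isChain_cons hc).tail, h.isChain_cons hc']
  encard := by
    have key : ∀ (c : List ℕ → Finset ℕ) (u : List ℕ), IsBranching n k c →
        ((insert (u.getLastD k) (c u) : Finset ℕ) : Set ℕ).encard = n := by
      intro c u hc
      rw [encard_coe_eq_coe_finsetCard, Finset.card_insert_of_notMem (hc u).2, (hc u).1,
        Nat.sub_add_cancel hn]
    rintro w (h | ⟨w, rfl, h⟩)
    · rw [← key c w hc]
      congr 1
      ext l
      cases w with
      | nil => simp [joinBranches, InBranch, or_comm]
      | cons a w =>
        have ha : a ≠ k := fun e => not_inBranch_cons hc (e ▸ h)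
        rw [mem_ofPred_eq, joinBranches, inBranch_concat, List.getLast?_cons]
        simp [h, Ne.symm ha, List.getLast?_cons, or_comm, eq_comm]
    · rw [← key c' w hc']
      congr 1
      ext l
      rw [mem_ofPred_eq, joinBranches, List.cons_append, List.getLast?_cons]
      simp [not_inBranch_cons hc, inBranch_concat, h, or_comm, eq_comm]

theorem reroot_joinBranches {c c' : List ℕ → Finset ℕ} (hc : IsBranching n k c)
    (hc' : IsBranching n k c') : reroot k (joinBranches k c c') = joinBranches k c' c := by
  funext w
  rw [reroot, joinBranches, joinBranches]
  match w with
  | [] => simp [consMul, InBranch]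
  | a :: w =>
    by_cases ha : a = k
    · subst ha
      have h1 : (a :: w).IsChain (· ≠ ·) → ∀ w', w ≠ a :: w' := by
        rintro h w' rfl
        exact (List.isChain_cons_cons.1 h).1 rfl
      have h2 := fun h : InBranch c w => h.isChain_cons hc
      simp [consMul, not_inBranch_cons hc']
      refine ⟨?_, fun h => ⟨h2 h, .inl h⟩⟩
      rintro ⟨h, h' | ⟨w', hw', -⟩⟩
      exacts [h', absurd hw' (h1 h w')]
    · have h2 := fun h : InBranch c' (a :: w) => (h.isChain_cons hc').tail
      simp [consMul, ha, not_inBranch_cons hc]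
      exact h2

theorem joinBranches_congr {c c' d d' : List ℕ → Finset ℕ} {w : List ℕ}
    (h : ∀ u, u.length < w.length → c u = d u) (h' : ∀ u, u.length < w.length → c' u = d' u) :
    joinBranches k c c' w ↔ joinBranches k d d' w := by
  refine or_congr (inBranch_congr h) (exists_congr fun w' => and_congr_right fun e => ?_)
  refine inBranch_congr fun u hu => h' u (hu.trans ?_)
  simp [e]

instance : Inhabited {c // IsBranching n k c} :=
  ⟨fun u => Finset.Ioc (u.getLastD k) (u.getLastD k + (n - 1)), fun u => by simp⟩

/-- The tree of finite sequences, listed from the last to the first term. -/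
abbrev seqTree (α : Type) [Inhabited α] : GameTree where
  Pos := List α
  len := List.length
  par := List.tail
  len_par _ := List.length_tail
  exists_child p := ⟨default :: p, rfl, rfl⟩

section Sequences

variable {α : Type} [Inhabited α]

/-- The `m`-th move of a play. -/
def GameTree.Play.move (x : (seqTree α).Play) (m : ℕ) : α := List.headI (x.pos (m + 1))

/-- The positions of the play in which player `j` follows the strategy `s` and the other one plays
the terms of `d`. -/
def againstPos (j : ℕ) (s : (seqTree α).Strat) (d : ℕ → α) : ℕ → List α
  | 0 => []
  | m + 1 => if m % 2 = j then s.mv (againstPos j s d m) else d m :: againstPos j s d m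

theorem child_againstPos (j : ℕ) (s : (seqTree α).Strat) (d : ℕ → α) (m : ℕ) :
    (seqTree α).Child (againstPos j s d m) (againstPos j s d (m + 1)) := by
  rw [againstPos]
  split_ifs
  exacts [s.child _, ⟨rfl, rfl⟩]

/-- The play with positions `againstPos j s d`. -/
def against (j : ℕ) (s : (seqTree α).Strat) (d : ℕ → α) : (seqTree α).Play where
  pos := againstPos j s d
  len_pos m := by
    induction m with
    | zero => rfl
    | succ m ih => exact (child_againstPos j s d m).1.trans (congrArg (· + 1) ih)
  par_pos m := (child_againstPos j s d m).2

theorem followsFrom_against (j : ℕ) (s : (seqTree α).Strat) (d : ℕ → α) :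
    GameTree.FollowsFrom j s 0 (against j s d) := fun _ _ h => if_pos h

theorem move_against {j m : ℕ} {s : (seqTree α).Strat} {d : ℕ → α} (h : m % 2 ≠ j) :
    (against j s d).move m = d m := by
  change List.headI (if m % 2 = j then s.mv (againstPos j s d m) else d m :: _) = d m
  rw [if_neg h]
  rfl

theorem againstPos_congr {j m : ℕ} {s : (seqTree α).Strat} {d d' : ℕ → α}
    (h : ∀ i < m, i % 2 ≠ j → d i = d' i) : againstPos j s d m = againstPos j s d' m := by
  induction m with
  | zero => rfl
  | succ m ih =>
    rw [againstPos, againstPos, ih fun i hi => h i (hi.trans m.lt_succ_self)]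
    split_ifs with hj
    exacts [rfl, by rw [h m m.lt_succ_self hj]]

end Sequences

/-- Two branches agreeing on the words of length at most `t`. -/
def AgreeUpTo (t : ℕ) (c d : {c // IsBranching n k c}) : Prop :=
  ∀ u, u.length ≤ t → c.1 u = d.1 u

/-- The branch whose vertices at height `t` have the children prescribed by the term of index
`2 * t + j` of the sequence `a`. -/
def assemble (j : ℕ) (a : ℕ → {c // IsBranching n k c}) : {c // IsBranching n k c} :=
  ⟨fun u => (a (2 * u.length + j)).1 u, fun u => (a (2 * u.length + j)).2 u⟩

/-- The branch `c` with its part above the height `t` replaced by a default one. -/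
def truncate (t : ℕ) (c : {c // IsBranching n k c}) : {c // IsBranching n k c} :=
  ⟨fun u => if u.length ≤ t then c.1 u else (default : {c // IsBranching n k c}).1 u, fun u => by
    beta_reduce
    split_ifs
    exacts [c.2 u, (default : {c // IsBranching n k c}).2 u]⟩

theorem AgreeUpTo.truncate_eq {t : ℕ} {c d : {c // IsBranching n k c}} (h : AgreeUpTo t c d) :
    truncate t c = truncate t d := by
  refine Subtype.ext (funext fun u => ?_)
  by_cases hu : u.length ≤ t <;> simp [truncate, hu, h u]

/-- The branch played by a strategy for the player `j` against the branch `c`. -/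
def respond (j : ℕ) (s : (seqTree {c // IsBranching n k c}).Strat) (c : {c // IsBranching n k c}) :
    (seqTree {c // IsBranching n k c}).Play :=
  against j s fun m => truncate (m / 2) c

theorem assemble_move_respond {i j : ℕ} (hi : i < 2) (hij : i ≠ j)
    (s : (seqTree {c // IsBranching n k c}).Strat) (c : {c // IsBranching n k c}) :
    assemble i (respond j s c).move = c := by
  refine Subtype.ext (funext fun u => ?_)
  simp only [assemble, respond]
  rw [move_against (by omega)]
  exact if_pos (by omega)

theorem agreeUpTo_assemble_move_respond {j t : ℕ} (hj : j < 2)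
    (s : (seqTree {c // IsBranching n k c}).Strat) {c d : {c // IsBranching n k c}}
    (h : AgreeUpTo t c d) :
    AgreeUpTo t (assemble j (respond j s c).move) (assemble j (respond j s d).move) := by
  intro u hu
  have : againstPos j s (fun m => truncate (m / 2) c) (2 * u.length + j + 1) =
      againstPos j s (fun m => truncate (m / 2) d) (2 * u.length + j + 1) :=
    againstPos_congr fun i hi _ =>
      AgreeUpTo.truncate_eq fun v hv => h v (hv.trans (by omega))
  simp only [assemble, GameTree.Play.move, respond, against, this]

/-- The tree made of two branches joined by an edge of label `k`. -/
def joinTree (hn : 1 ≤ n) (c c' : {c // IsBranching n k c}) : {A : List ℕ → Prop // IsTree n A} :=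
  ⟨joinBranches k c.1 c'.1, isTree_joinBranches hn c.2 c'.2⟩

theorem measurable_joinTree (hn : 1 ≤ n) :
    Measurable fun x : (seqTree {c // IsBranching n k c}).Play =>
      joinTree hn (assemble 0 x.move) (assemble 1 x.move) := by
  refine measurable_of_forall_measurable_apply fun w => measurableSet_setOfPred.1 ?_
  refine GameTree.Decided.measurableSet (N := 2 * w.length) fun x y h => ?_
  have hm : ∀ i < 2 * w.length, x.move i = y.move i := fun i hi =>
    congrArg List.headI (GameTree.Play.eq_of_le hi h)
  refine joinBranches_congr (fun u hu => ?_) fun u hu => ?_ <;>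
  · simp only [assemble]
    rw [hm _ (by omega)]

theorem nb_joinTree (hn : 1 ≤ n) (c c' : {c // IsBranching n k c}) (b : Bool) :
    (joinTree hn c c', b) ∈ (treeGraph n).dom k ∧
      (treeGraph n).nb k (joinTree hn c c', b) = (joinTree hn c' c, !b) := by
  have h : (joinTree hn c c').1 [k] := .inr ⟨[], rfl, trivial⟩
  refine ⟨h, Prod.ext ?_ rfl⟩
  have hr := reroot_joinBranches c.2 c'.2
  exact (dif_pos h).trans (Subtype.ext hr)

/-- For one of the two sides, there is a continuous way to complete a branch to a tree at which the
edge of label `k` points inwards. -/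
theorem exists_respond (hn : 1 ≤ n) {O : ℕ → Set ({A : List ℕ → Prop // IsTree n A} × Bool)}
    (hO : (treeGraph n).IsOrientation O) (k : ℕ) :
    ∃ b, ∃ F : {c // IsBranching n k c} → {c // IsBranching n k c},
      (∀ t c d, AgreeUpTo t c d → AgreeUpTo t (F c) (F d)) ∧
        ∀ c, (joinTree hn c (F c), b) ∉ O k := by
  have hB : MeasurableSet {x : (seqTree {c // IsBranching n k c}).Play |
      (joinTree hn (assemble 0 x.move) (assemble 1 x.move), false) ∈ O k} :=
    ((measurable_joinTree hn).prodMk measurable_const) (hO.1 k)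
  rcases GameTree.determined hB ([] : List _) rfl with ⟨s, hs⟩ | ⟨s, hs⟩
  · refine ⟨true, fun c => assemble 0 (respond 0 s c).move, fun t c d h =>
      agreeUpTo_assemble_move_respond two_pos s h, fun c h => ?_⟩
    have h1 := hs (respond 0 s c) rfl (followsFrom_against _ _ _)
    rw [mem_ofPred_eq, assemble_move_respond one_lt_two one_ne_zero] at h1
    have h2 := nb_joinTree hn c (assemble 0 (respond 0 s c).move) true
    exact (hO.2 k _ h2.1).1 h (h2.2 ▸ h1)
  · refine ⟨false, fun c => assemble 1 (respond 1 s c).move, fun t c d h =>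
      agreeUpTo_assemble_move_respond one_lt_two s h, fun c h => ?_⟩
    have h1 := hs (respond 1 s c) rfl (followsFrom_against _ _ _)
    rw [mem_ofPred_eq, assemble_move_respond two_pos zero_ne_one] at h1
    exact h1 h

/-- The branches at a root whose edges have the labels in `K`, cut at the edge of label `k`. -/
def others (K : Finset ℕ) (hK : K.card = n) (c : ∀ l, {c // IsBranching n l c}) (k : ℕ) :
    {c // IsBranching n k c} :=
  ⟨fun
    | [] => if k ∈ K then K.erase k else (default : {c // IsBranching n k c}).1 []
    | l :: u => if l ∈ K.erase k then (c l).1 u else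
        (default : {c // IsBranching n k c}).1 (l :: u),
  fun
    | [] => by
      beta_reduce
      split_ifs with h
      · exact ⟨by rw [Finset.card_erase_of_mem h, hK], Finset.notMem_erase k K⟩
      · exact (default : {c // IsBranching n k c}).2 []
    | l :: u => by
      by_cases h : l ∈ K.erase k
      · simpa only [h, if_true, List.getLastD_cons] using (c l).2 u
      · simpa only [h, if_false] using (default : {c // IsBranching n k c}).2 (l :: u)⟩

theorem agreeUpTo_others {K : Finset ℕ} {hK : K.card = n} {c d : ∀ l, {c // IsBranching n l c}}
    {t : ℕ} (h : ∀ l u, u.length < t → (c l).1 u = (d l).1 u) (k : ℕ) :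
    AgreeUpTo t (others K hK c k) (others K hK d k) := by
  rintro (_ | ⟨l, u⟩) hu
  · rfl
  · simp only [others, h l u hu]

theorem exists_fixed_branches {K : Finset ℕ} (hK : K.card = n)
    {F : ∀ k, {c // IsBranching n k c} → {c // IsBranching n k c}}
    (hF : ∀ k t c d, AgreeUpTo t c d → AgreeUpTo t (F k c) (F k d)) :
    ∃ c : ∀ l, {c // IsBranching n l c}, ∀ k, F k (others K hK c k) = c k := by
  let C : ℕ → ∀ l, {c // IsBranching n l c} := fun m =>
    Nat.rec (fun _ => default) (fun _ c k => F k (others K hK c k)) m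
  have hstep : ∀ m l u, u.length < m → (C m l).1 u = (C (m + 1) l).1 u := by
    intro m
    induction m with
    | zero => exact fun l u hu => absurd hu (Nat.not_lt_zero _)
    | succ m ih => exact fun l u hu => hF l m _ _ (agreeUpTo_others ih l) u (Nat.lt_succ_iff.1 hu)
  have hstab : ∀ m l u, u.length < m → (C m l).1 u = (C (u.length + 1) l).1 u := by
    intro m l u hu
    induction m, hu using Nat.le_induction with
    | base => rfl
    | succ m hm ih => rw [← hstep m l u hm, ih]
  let c : ∀ l, {c // IsBranching n l c} := fun l =>
    ⟨fun u => (C (u.length + 1) l).1 u, fun u => (C (u.length + 1) l).2 u⟩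
  refine ⟨c, fun k => Subtype.ext (funext fun u => ?_)⟩
  exact hF k u.length _ _ (agreeUpTo_others (fun l v hv => (hstab _ l v hv).symm) k) u le_rfl

theorem joinBranches_others {K : Finset ℕ} (hK : K.card = n) (c : ∀ l, {c // IsBranching n l c})
    (hk : k ∈ K) (w : List ℕ) : joinBranches k (others K hK c k).1 (c k).1 w ↔
      w = [] ∨ ∃ l ∈ K, ∃ u, w = l :: u ∧ InBranch (c l).1 u := by
  cases w with
  | nil => simp [joinBranches, InBranch]
  | cons l u =>
    have h1 : l ∈ K.erase k → (fun v => (others K hK c k).1 (l :: v)) = (c l).1 := fun hl =>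
      funext fun v => if_pos hl
    have h2 : (others K hK c k).1 [] = K.erase k := if_pos hk
    rw [joinBranches, InBranch, h2]
    constructor
    · rintro (⟨hl, h⟩ | ⟨w', e, h⟩)
      · exact .inr ⟨l, Finset.mem_of_mem_erase hl, u, rfl, h1 hl ▸ h⟩
      · obtain ⟨rfl, rfl⟩ := List.cons.inj e
        exact .inr ⟨l, hk, u, rfl, h⟩
    · rintro (h | ⟨l', hl', u', e, h⟩)
      · cases h
      · obtain ⟨rfl, rfl⟩ := List.cons.inj e
        by_cases hlk : l = k
        · subst hlk
          exact .inr ⟨u, rfl, h⟩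
        · have hl := Finset.mem_erase.2 ⟨hlk, hl'⟩
          exact .inl ⟨hl, (h1 hl).symm ▸ h⟩

theorem not_exists_isOrientation_treeGraph (hn : 1 ≤ n) :
    ¬∃ O, (treeGraph n).IsOrientation O ∧ ∀ v, (treeGraph n).HasOut O v := by
  rintro ⟨O, hO, hout⟩
  choose b F hF hFO using exists_respond hn hO
  obtain ⟨i, hi⟩ : ∃ i, {k | b k = i}.Infinite := by
    by_contra! hcon
    refine infinite_univ (α := ℕ) (((hcon false).union (hcon true)).subset fun k _ => ?_)
    cases h : b k
    exacts [.inl h, .inr h]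
  obtain ⟨K, hKi, hK⟩ := hi.exists_subset_card_eq n
  obtain ⟨c, hc⟩ := exists_fixed_branches hK hF
  have hb : ∀ k ∈ K, (joinTree hn (others K hK c k) (c k), i) ∉ O k := by
    intro k hk h
    have hbk : b k = i := hKi hk
    refine hFO k (others K hK c k) ?_
    rwa [hc, hbk]
  obtain ⟨k, hk⟩ := Finset.card_pos.1 (hK ▸ hn)
  obtain ⟨l, hl, hlO⟩ := hout (joinTree hn (others K hK c k) (c k), i)
  have hlK : l ∈ K := by
    rcases (joinBranches_others hK c hk [l]).1 hl with h | ⟨l', hl', u, e, -⟩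
    · cases h
    · rwa [(List.cons.inj e).1]
  have he : joinTree hn (others K hK c k) (c k) = joinTree hn (others K hK c l) (c l) :=
    Subtype.ext (funext fun w => propext
      ((joinBranches_others hK c hk w).trans (joinBranches_others hK c hlK w).symm))
  exact hb l hlK (he ▸ hlO)

end

/-- For every `n ≥ 1`, there exists an `n`-regular acyclic Borel bipartite graph with no
Borel edge coloring with `2n − 2` colors. An edge coloring is given as a Borel function
on ordered pairs that is symmetric on edges and assigns different colors to distinct
intersecting edges. -/
theorem stmt_9 (n : ℕ) (hn : 1 ≤ n) :
    ∃ (X : Type) (mX : MeasurableSpace X) (G : SimpleGraph X),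
      @StandardBorelSpace X mX ∧
      @MeasurableSet (X × X) (@Prod.instMeasurableSpace X X mX mX)
        {p : X × X | G.Adj p.1 p.2} ∧
      (∀ x, (G.neighborSet x).encard = n) ∧
      G.IsAcyclic ∧
      (∃ A : Set X, @MeasurableSet X mX A ∧ ∀ x y, G.Adj x y → (x ∈ A ↔ y ∉ A)) ∧
      ¬∃ c : X × X → Fin (2 * n - 2),
        @Measurable (X × X) (Fin (2 * n - 2)) (@Prod.instMeasurableSpace X X mX mX) _ c ∧
        (∀ x y, G.Adj x y → c (x, y) = c (y, x)) ∧
        (∀ x y z, G.Adj x y → G.Adj x z → y ≠ z → c (x, y) ≠ c (x, z)) := by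
  exact LabelledGraph.exists_simpleGraph hn (not_exists_isOrientation_treeGraph hn)
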